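/- arXiv:2212.12027 — 2 statements merged into one kernel-verified Lean document; each statement's English description precedes it below -/
import Mathlib

section
/- Let 𝔞 be an ideal of R, M a finitely generated R-module, and T = R ⋉ M the trivial extension. Then grade(𝔞T, T) = min{grade(𝔞, R), grade(𝔞, M)} and cd(𝔞T, T) = cd(𝔞, R), where 𝔞T is the extension of 𝔞 along the canonical injection R → T. -/
open CategoryTheory TensorProduct

noncomputable section

universe u

/-- The cohomological dimension `cd(𝔞, M)`: the largest `i` (in `ℕ∞`) such that the local
cohomology module `H^i_𝔞(M)` is nonzero. -/
noncomputable def cohDim {R : Type u} [CommRing R] (a : Ideal R)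
    (M : Type u) [AddCommGroup M] [Module R M] : ℕ∞ :=
  sSup ((fun i : ℕ => (i : ℕ∞)) ''
    {i : ℕ | Nontrivial ((localCohomology a i).obj (ModuleCat.of R M))})

/-- The grade `grade(𝔞, M)`: the least `i` (in `ℕ∞`) such that `Ext^i_R(R/𝔞, M) ≠ 0`. -/
noncomputable def relGrade {R : Type u} [CommRing R] (a : Ideal R)
    (M : Type u) [AddCommGroup M] [Module R M] : ℕ∞ :=
  sInf ((fun i : ℕ => (i : ℕ∞)) ''
    {i : ℕ | Nontrivial (((Ext R (ModuleCat.{u} R) i).obj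
      (Opposite.op (ModuleCat.of R (R ⧸ a)))).obj (ModuleCat.of R M))})

/-- `M` is `𝔞`-relative Cohen-Macaulay: `M = 𝔞M`, or `M ≠ 𝔞M` and `grade(𝔞,M) = cd(𝔞,M)`. -/
def IsRelCM {R : Type u} [CommRing R] (a : Ideal R)
    (M : Type u) [AddCommGroup M] [Module R M] : Prop :=
  a • (⊤ : Submodule R M) = ⊤ ∨
    (a • (⊤ : Submodule R M) ≠ ⊤ ∧ relGrade a M = cohDim a M)

/-- `M` is `𝔞`-relative maximal Cohen-Macaulay: `grade(𝔞,M) = cd(𝔞,R)`. -/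
def IsRelMCM {R : Type u} [CommRing R] (a : Ideal R)
    (M : Type u) [AddCommGroup M] [Module R M] : Prop :=
  relGrade a M = cohDim a R

/-- `M` is `𝔞`-relative Gorenstein: `Ext^i_R(R/𝔞, M) = 0` for all `i ≠ cd(𝔞,R)`. -/
def IsRelGorenstein {R : Type u} [CommRing R] (a : Ideal R)
    (M : Type u) [AddCommGroup M] [Module R M] : Prop :=
  ∀ i : ℕ, (i : ℕ∞) ≠ cohDim a R →
    Subsingleton (((Ext R (ModuleCat.{u} R) i).obj
      (Opposite.op (ModuleCat.of R (R ⧸ a)))).obj (ModuleCat.of R M))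

/-- `M` is `𝔞`-relative regular: `M = 𝔞M`, or `M ≠ 𝔞M` and `𝔞` is generated by a sequence of
length `cd(𝔞,R)` which is both an `M`-regular sequence and an `R`-regular sequence. -/
def IsRelRegular {R : Type u} [CommRing R] (a : Ideal R)
    (M : Type u) [AddCommGroup M] [Module R M] : Prop :=
  a • (⊤ : Submodule R M) = ⊤ ∨
    (a • (⊤ : Submodule R M) ≠ ⊤ ∧ ∃ rs : List R,
      (rs.length : ℕ∞) = cohDim a R ∧ Ideal.span {x | x ∈ rs} = a ∧
      RingTheory.Sequence.IsRegular M rs ∧ RingTheory.Sequence.IsRegular R rs)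

/-- A ring map (given as an algebra) `R → T` is pure if `N → T ⊗[R] N`, `n ↦ 1 ⊗ n`,
is injective for every `R`-module `N`. -/
def IsPureAlgebra (R T : Type u) [CommRing R] [CommRing T] [Algebra R T] : Prop :=
  ∀ (N : Type u) [AddCommGroup N] [Module R N],
    Function.Injective (fun n : N => (1 : T) ⊗ₜ[R] n)

namespace Br
variable {R : Type u} [CommRing R]
open Opposite HomologicalComplex

def lyMap {P Q : ChainComplex (ModuleCat.{u} R) ℕ} (φ : P ⟶ Q) (Y : ModuleCat.{u} R) :
    Q.linearYonedaObj R Y ⟶ P.linearYonedaObj R Y :=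
  (HomologicalComplex.unopFunctor _ _).map
    (((((linearYoneda R (ModuleCat.{u} R)).obj Y).rightOp.mapHomologicalComplex _).map φ).op)

lemma lyMap_f {P Q : ChainComplex (ModuleCat.{u} R) ℕ} (φ : P ⟶ Q) (Y : ModuleCat.{u} R) (n : ℕ)
    (f : Q.X n ⟶ Y) : ((lyMap φ Y).f n).hom f = φ.f n ≫ f := rfl

lemma paste {C : Type*} [Category C] {A B A' B' A'' B'' : C} (a : A ⟶ B) (i : B ⟶ B') (k : B' ⟶ B'')
    (j : A ⟶ A') (l : A' ⟶ A'') (b : A' ⟶ B') (m : A'' ⟶ B'') (h : a ≫ i = j ≫ b)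
    (h' : b ≫ k = l ≫ m) : a ≫ i ≫ k = (j ≫ l) ≫ m := by
  rw [← Category.assoc, h, Category.assoc, h', Category.assoc]

lemma paste2 {C : Type*} [Category C] {H H' : Cᵒᵖ} {A A' : C} (α : H ≅ op A) (α' : H' ≅ op A')
    (m : H' ⟶ H) (f : A ⟶ A') (e : m ≫ α.hom = α'.hom ≫ f.op) :
    m.unop ≫ α'.inv.unop = α.inv.unop ≫ f := by
  apply Quiver.Hom.op_inj
  simp only [op_comp, Quiver.Hom.op_unop]
  rw [Iso.inv_comp_eq, ← Category.assoc, ← e, Category.assoc, Iso.hom_inv_id, Category.comp_id]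

lemma isoExt_nat {X X' Y : ModuleCat.{u} R} (g : X' ⟶ X) (P' : ProjectiveResolution X')
    (P : ProjectiveResolution X) (φ : ProjectiveResolution.Hom P' P g) (n : ℕ) :
    ((Ext R (ModuleCat.{u} R) n).map g.op).app Y ≫ (P'.isoExt (R := R) n Y).hom =
      (P.isoExt n Y).hom ≫ homologyMap (lyMap φ.hom Y) n := by
  have h1 := ProjectiveResolution.isoLeftDerivedObj_inv_naturality g P' P φ.hom
    (by simpa using φ.hom_f_zero_comp_π_f_zero) ((linearYoneda R (ModuleCat.{u} R)).obj Y).rightOp n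
  have h1' := congrArg Quiver.Hom.unop h1
  have e := paste2 _ _ _ _ (homologyOp_hom_naturality (lyMap φ.hom Y) n)
  exact paste _ _ _ _ _ _ _ h1' e

lemma mk_surj (K : CochainComplex (ModuleCat.{u} R) ℕ) (n : ℕ) (h : K.homology n) :
    ∃ z : K.cycles n, (K.homologyπ n).hom z = h :=
  (ModuleCat.epi_iff_surjective (K.homologyπ n)).1 inferInstance h

lemma mk_zero (K : CochainComplex (ModuleCat.{u} R) ℕ) (n : ℕ) (z : K.cycles n) :
    (K.homologyπ n).hom z = 0 ↔ ∃ y, (K.d ((ComplexShape.up ℕ).prev n) n).hom y = (K.iCycles n).hom z := by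
  have h1 : (ShortComplex.mk (K.toCycles ((ComplexShape.up ℕ).prev n) n) (K.homologyπ n) (by simp)).Exact :=
    ShortComplex.exact_of_g_is_cokernel _ (K.homologyIsCokernel _ n rfl)
  rw [ShortComplex.moduleCat_exact_iff] at h1
  have inj : Function.Injective (K.iCycles n).hom :=
    (ModuleCat.mono_iff_injective (K.iCycles n)).1 inferInstance
  constructor
  · intro h
    obtain ⟨y, hy⟩ := h1 z h
    refine ⟨y, ?_⟩
    dsimp at hy
    rw [← hy, ← K.toCycles_i]; rfl
  · rintro ⟨y, hy⟩
    have : (K.toCycles ((ComplexShape.up ℕ).prev n) n).hom y = z := by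
      apply inj
      rw [← hy, ← K.toCycles_i]; rfl
    rw [← this]
    have := K.toCycles_comp_homologyπ ((ComplexShape.up ℕ).prev n) n
    exact congrArg (fun f => f.hom y) this

lemma cyc_lift (K : CochainComplex (ModuleCat.{u} R) ℕ) (n : ℕ) (x : K.X n)
    (hx : (K.d n (n+1)).hom x = 0) : ∃ z : K.cycles n, (K.iCycles n).hom z = x := by
  have h1 : (ShortComplex.mk (K.iCycles n) (K.d n (n+1)) (by simp)).Exact :=
    ShortComplex.exact_of_f_is_kernel _ (K.cyclesIsKernel n _ (by simp))
  rw [ShortComplex.moduleCat_exact_iff] at h1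
  exact h1 x hx

open Abelian

lemma extMk_zero_iff {X Y : ModuleCat.{u} R} (P : ProjectiveResolution X) (f : P.complex.X 0 ⟶ Y)
    (hf : P.complex.d 1 0 ≫ f = 0) : P.extMk f 1 rfl hf = 0 ↔ f = 0 := by
  constructor
  · intro h
    rw [← P.extEquivCohomologyClass.apply_eq_iff_eq,
      ProjectiveResolution.extEquivCohomologyClass_extMk, ProjectiveResolution.extEquivCohomologyClass_zero,
      CochainComplex.HomComplex.CohomologyClass.mk_eq_zero_iff] at h
    rw [CochainComplex.HomComplex.Cocycle.toSingleMk_mem_coboundaries_iff _ _ _ _ _ 1 (by simp)] at h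
    obtain ⟨g, hg⟩ := h
    have hz : Limits.IsZero (P.cochainComplex.X 1) := by
      exact CochainComplex.isZero_of_isStrictlyLE _ 0 1 (by simp)
    rw [hz.eq_of_src g 0, Limits.comp_zero] at hg
    rw [← cancel_epi (P.cochainComplexXIso (-((0:ℕ):ℤ)) 0 rfl).hom]
    rw [← hg, Limits.comp_zero]
  · rintro rfl; simp

/-- relation between the two models of Ext -/
def Rel {X Y : ModuleCat.{u} R} (P : ProjectiveResolution X) (n : ℕ)
    (o : ((Ext R (ModuleCat.{u} R) n).obj (op X)).obj Y) (x : Abelian.Ext X Y n) : Prop :=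
  ∃ (f : P.complex.X n ⟶ Y) (hf : P.complex.d (n+1) n ≫ f = 0)
    (z : (P.complex.linearYonedaObj R Y).cycles n),
    ((P.complex.linearYonedaObj R Y).iCycles n).hom z = f ∧
    ((P.complex.linearYonedaObj R Y).homologyπ n).hom z = (P.isoExt (R := R) n Y).hom.hom o ∧
    x = P.extMk f (n+1) rfl hf

variable {X Y : ModuleCat.{u} R} (P : ProjectiveResolution X) (n : ℕ)

lemma lift_pf {X' : ModuleCat.{u} R} (P' : ProjectiveResolution X') (g : X' ⟶ X) :
    (ProjectiveResolution.lift g P' P).f 0 ≫ P.π.f 0 = P'.π.f 0 ≫ ((ChainComplex.single₀ _).map g).f 0 :=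
  ProjectiveResolution.lift_commutes_zero g P' P

def homLift {X' : ModuleCat.{u} R} (P' : ProjectiveResolution X') (g : X' ⟶ X) :
    ProjectiveResolution.Hom P' P g :=
  ⟨ProjectiveResolution.lift g P' P, lift_pf P P' g⟩

lemma Rel.total (o : ((Ext R (ModuleCat.{u} R) n).obj (op X)).obj Y) : ∃ x, Rel P n o x := by
  obtain ⟨z, hz⟩ := mk_surj _ _ ((P.isoExt (R := R) n Y).hom.hom o)
  have : P.complex.d (n+1) n ≫ ((P.complex.linearYonedaObj R Y).iCycles n).hom z = 0 := by
    have := (P.complex.linearYonedaObj R Y).iCycles_d n (n+1)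
    exact congrArg (fun f => f.hom z) this
  exact ⟨_, _, this, z, rfl, hz, rfl⟩

lemma Rel.surj (x : Abelian.Ext X Y n) : ∃ o, Rel P n o x := by
  obtain ⟨f, hf, rfl⟩ := P.extMk_surjective x (n+1) rfl
  obtain ⟨z, hz⟩ := cyc_lift (P.complex.linearYonedaObj R Y) n f hf
  refine ⟨(P.isoExt (R := R) n Y).inv.hom (((P.complex.linearYonedaObj R Y).homologyπ n).hom z),
    f, hf, z, hz, ?_, rfl⟩
  simp

variable {P n} in
lemma Rel.zero_iff {o : ((Ext R (ModuleCat.{u} R) n).obj (op X)).obj Y} {x : Abelian.Ext X Y n}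
    (h : Rel P n o x) : o = 0 ↔ x = 0 := by
  obtain ⟨f, hf, z, hz, ho, rfl⟩ := h
  have e : o = 0 ↔ (P.isoExt (R := R) n Y).hom.hom o = 0 := by
    constructor
    · rintro rfl; simp
    · intro h
      have := congrArg (P.isoExt (R := R) n Y).inv.hom h
      simpa using this
  rw [e, ← ho, mk_zero, hz]
  cases n with
  | zero =>
    rw [extMk_zero_iff]
    constructor
    · rintro ⟨y, hy⟩
      rw [HomologicalComplex.shape] at hy
      · exact hy.symm
      · simp
    · rintro rfl
      exact ⟨0, map_zero _⟩
  | succ p =>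
    rw [P.extMk_eq_zero_iff _ _ _ _ p rfl]
    have : (ComplexShape.up ℕ).prev (p+1) = p := by simp
    rw [this]
    rfl

variable {P n} in
lemma Rel.nat {X' : ModuleCat.{u} R} {g : X' ⟶ X} {P' : ProjectiveResolution X'}
    (φ : ProjectiveResolution.Hom P' P g)
    {o : ((Ext R (ModuleCat.{u} R) n).obj (op X)).obj Y} {x : Abelian.Ext X Y n}
    (h : Rel P n o x) : Rel P' n ((((Ext R (ModuleCat.{u} R) n).map g.op).app Y).hom o)
      ((Abelian.Ext.mk₀ g).comp x (zero_add _)) := by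
  obtain ⟨f, hf, z, hz, ho, rfl⟩ := h
  rw [ProjectiveResolution.mk₀_comp_extMk _ _ _ _ φ]
  refine ⟨_, _, (cyclesMap (lyMap φ.hom Y) n).hom z, ?_, ?_, rfl⟩
  · have := congrArg (fun f => f.hom z) (cyclesMap_i (lyMap φ.hom Y) n)
    refine this.trans ?_
    rw [← lyMap_f, ← hz]; rfl
  · have := congrArg (fun f => f.hom z) (homologyπ_naturality (lyMap φ.hom Y) n)
    refine this.symm.trans ?_
    have h2 := congrArg (fun f => f.hom o) (isoExt_nat (Y := Y) g P' P φ n)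
    refine Eq.trans ?_ h2.symm
    change (homologyMap (lyMap φ.hom Y) n).hom _ = (homologyMap (lyMap φ.hom Y) n).hom _
    exact congrArg _ ho

theorem nontrivial_iff (X Y : ModuleCat.{u} R) (n : ℕ) :
    Nontrivial (((Ext R (ModuleCat.{u} R) n).obj (op X)).obj Y) ↔ ∃ x : Abelian.Ext X Y n, x ≠ 0 := by
  rw [nontrivial_iff_exists_ne 0]
  let P := projectiveResolution X
  constructor
  · rintro ⟨o, ho⟩
    obtain ⟨x, hx⟩ := Rel.total P n o
    exact ⟨x, fun h => ho (hx.zero_iff.2 h)⟩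
  · rintro ⟨x, ho⟩
    obtain ⟨o, hx⟩ := Rel.surj P n x
    exact ⟨o, fun h => ho (hx.zero_iff.1 h)⟩

/-- the transition maps -/
def tr (a : Ideal R) {s t : ℕ} (h : s ≤ t) : ModuleCat.of R (R ⧸ a ^ t) ⟶ ModuleCat.of R (R ⧸ a ^ s) :=
  ModuleCat.ofHom (Submodule.mapQ _ _ LinearMap.id (Ideal.pow_le_pow_right h))

/-- vanishing of local cohomology -/
def V (a : Ideal R) (i : ℕ) (N : ModuleCat.{u} R) : Prop :=
  ∀ (s : ℕ) (x : Abelian.Ext (ModuleCat.of R (R ⧸ a ^ s)) N i),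
    ∃ (t : ℕ) (h : s ≤ t), (Abelian.Ext.mk₀ (tr a h)).comp x (zero_add _) = 0

open Limits in
theorem nontrivial_lc_iff (a : Ideal R) (N : ModuleCat.{u} R) (i : ℕ) :
    Nontrivial ((localCohomology a i).obj N) ↔ ¬ V a i N := by
  rw [← not_subsingleton_iff_nontrivial, not_iff_not]
  let D := localCohomology.diagram (localCohomology.idealPowersDiagram a) i
  let F : ℕᵒᵖᵒᵖ ⥤ ModuleCat.{u} R := D ⋙ (evaluation _ _).obj N
  have hD : HasColimit D := localCohomology.hasColimitDiagram.{u, 0} _ _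
  let c : Cocone F := ((evaluation _ _).obj N).mapCocone (colimit.cocone D)
  have hc : IsColimit c := isColimitOfPreserves _ (colimit.isColimit D)
  change Subsingleton c.pt ↔ _
  have : PreservesFilteredColimitsOfSize.{0, 0} (forget (ModuleCat.{u} R)) :=
    preservesFilteredColimitsOfSize_shrink.{0, u, 0, u} _
  have key : Subsingleton c.pt ↔ ∀ (j : ℕᵒᵖᵒᵖ) (o : F.obj j), ∃ (k : ℕᵒᵖᵒᵖ) (f : j ⟶ k),
      (F.map f).hom o = 0 := by
    constructor
    · intro h j o
      obtain ⟨k, f, hf⟩ := (IsColimit.eq_iff' hc o 0).1 (h.elim _ _)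
      exact ⟨k, f, hf.trans (map_zero (F.map f).hom)⟩
    · intro h
      refine subsingleton_of_forall_eq 0 fun y => ?_
      obtain ⟨j, o, rfl⟩ := Concrete.isColimit_exists_rep F hc y
      obtain ⟨k, f, hf⟩ := h j o
      have := (IsColimit.eq_iff' hc o 0).2 ⟨k, f, hf.trans (map_zero (F.map f).hom).symm⟩
      exact this.trans (map_zero (c.ι.app j).hom)
  rw [key]
  constructor
  · intro h s x
    obtain ⟨o, hx⟩ := Rel.surj (projectiveResolution _) i x
    obtain ⟨k, f, hf⟩ := h (op (op s)) o
    refine ⟨k.unop.unop, leOfHom f.unop.unop, ?_⟩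
    exact (hx.nat (P' := projectiveResolution _) (g := tr a (leOfHom f.unop.unop))
      (homLift _ _ _)).zero_iff.1 hf
  · intro h j o
    obtain ⟨x, hx⟩ := Rel.total (projectiveResolution _) i o
    obtain ⟨t, ht, hf⟩ := h j.unop.unop x
    refine ⟨op (op t), (homOfLE ht).op.op, ?_⟩
    exact (hx.nat (P' := projectiveResolution _) (g := tr a ht)
      (homLift _ _ _)).zero_iff.2 hf
end Br

namespace Br
variable {R : Type u} [CommRing R]
open Opposite Abelian

lemma ses {A B C : Type u} [AddCommGroup A] [AddCommGroup B] [AddCommGroup C] [Module R A] [Module R B]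
    [Module R C] (f : A →ₗ[R] B) (g : B →ₗ[R] C) (hf : Function.Injective f)
    (hg : Function.Surjective g) (h : Function.Exact f g) :
    (ShortComplex.mk (ModuleCat.ofHom f) (ModuleCat.ofHom g)
      (by ext x; exact h.apply_apply_eq_zero x)).ShortExact where
  exact := by
    rw [ShortComplex.moduleCat_exact_iff]
    intro x hx
    exact (h x).1 hx
  mono_f := (ModuleCat.mono_iff_injective _).2 hf
  epi_g := (ModuleCat.epi_iff_surjective _).2 hg

lemma tr_comp (a : Ideal R) {s t w : ℕ} (h : s ≤ t) (h' : t ≤ w) :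
    tr a h' ≫ tr a h = tr a (h.trans h') := by
  apply ModuleCat.hom_ext
  apply LinearMap.ext
  intro x
  obtain ⟨x, rfl⟩ := Submodule.Quotient.mk_surjective _ x
  rfl

/-- pull back along a transition map -/
abbrev pull (a : Ideal R) {N : ModuleCat.{u} R} {i s t : ℕ} (h : s ≤ t)
    (x : Abelian.Ext (ModuleCat.of R (R ⧸ a ^ s)) N i) : Abelian.Ext (ModuleCat.of R (R ⧸ a ^ t)) N i :=
  (Abelian.Ext.mk₀ (tr a h)).comp x (zero_add _)

lemma pull_pull (a : Ideal R) {N : ModuleCat.{u} R} {i s t w : ℕ} (h : s ≤ t) (h' : t ≤ w)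
    (x : Abelian.Ext (ModuleCat.of R (R ⧸ a ^ s)) N i) :
    pull a h' (pull a h x) = pull a (h.trans h') x := by
  simp only [pull]
  rw [← tr_comp a h h', ← Ext.mk₀_comp_mk₀_assoc]

lemma pull_comp (a : Ideal R) {N N' : ModuleCat.{u} R} {i j k s t : ℕ} (h : s ≤ t)
    (x : Abelian.Ext (ModuleCat.of R (R ⧸ a ^ s)) N i) (y : Abelian.Ext N N' j) (hk : i + j = k) :
    pull a h (x.comp y hk) = (pull a h x).comp y hk := by
  simp only [pull]
  rw [Ext.comp_assoc _ _ _ _ _ (by lia)]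

variable (a : Ideal R)

lemma V_mid {S : ShortComplex (ModuleCat.{u} R)} (hS : S.ShortExact) {i : ℕ}
    (h1 : V a i S.X₁) (h3 : V a i S.X₃) : V a i S.X₂ := by
  intro s x
  obtain ⟨t, ht, hx⟩ := h3 s (x.comp (Ext.mk₀ S.g) (add_zero _))
  change pull a ht _ = 0 at hx
  rw [pull_comp] at hx
  obtain ⟨y, hy⟩ := Ext.covariant_sequence_exact₂ _ hS _ hx
  obtain ⟨w, hw, hyw⟩ := h1 t y
  refine ⟨w, ht.trans hw, ?_⟩
  change pull a _ _ = 0 at hyw ⊢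
  rw [← pull_pull a ht hw, ← hy, pull_comp, hyw, Ext.zero_comp]

lemma V_right {S : ShortComplex (ModuleCat.{u} R)} (hS : S.ShortExact) {i : ℕ}
    (h2 : V a i S.X₂) (h1 : V a (i+1) S.X₁) : V a i S.X₃ := by
  intro s x
  obtain ⟨t, ht, hx⟩ := h1 s (x.comp hS.extClass rfl)
  change pull a ht _ = 0 at hx
  rw [pull_comp] at hx
  obtain ⟨y, hy⟩ := Ext.covariant_sequence_exact₃ _ hS _ rfl hx
  obtain ⟨w, hw, hyw⟩ := h2 t y
  refine ⟨w, ht.trans hw, ?_⟩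
  change pull a _ _ = 0 at hyw ⊢
  rw [← pull_pull a ht hw, ← hy, pull_comp, hyw, Ext.zero_comp]

lemma V_left {S : ShortComplex (ModuleCat.{u} R)} (hS : S.ShortExact) {i : ℕ}
    (h3 : V a i S.X₃) (h2 : V a (i+1) S.X₂) : V a (i+1) S.X₁ := by
  intro s x
  obtain ⟨t, ht, hx⟩ := h2 s (x.comp (Ext.mk₀ S.f) (add_zero _))
  change pull a ht _ = 0 at hx
  rw [pull_comp] at hx
  obtain ⟨y, hy⟩ := Ext.covariant_sequence_exact₁ _ hS _ hx rfl
  obtain ⟨w, hw, hyw⟩ := h3 t y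
  refine ⟨w, ht.trans hw, ?_⟩
  change pull a _ _ = 0 at hyw ⊢
  rw [← pull_pull a ht hw, ← hy, pull_comp, hyw, Ext.zero_comp]

lemma V_retract {A B : ModuleCat.{u} R} (f : A ⟶ B) (g : B ⟶ A) (h : f ≫ g = 𝟙 A) {i : ℕ}
    (hB : V a i B) : V a i A := by
  intro s x
  obtain ⟨t, ht, hx⟩ := hB s (x.comp (Ext.mk₀ f) (add_zero _))
  refine ⟨t, ht, ?_⟩
  change pull a _ _ = 0 at hx ⊢
  have : (x.comp (Ext.mk₀ f) (add_zero _)).comp (Ext.mk₀ g) (add_zero _) = x := by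
    rw [Ext.comp_assoc _ _ _ _ (add_zero 0) (by lia), Ext.mk₀_comp_mk₀, h, Ext.comp_mk₀_id]
  rw [← this, pull_comp, hx, Ext.zero_comp]

lemma V_equiv {A B : Type u} [AddCommGroup A] [Module R A] [AddCommGroup B] [Module R B]
    (e : A ≃ₗ[R] B) {i : ℕ} (hB : V a i (ModuleCat.of R B)) : V a i (ModuleCat.of R A) :=
  V_retract a (ModuleCat.ofHom e.toLinearMap) (ModuleCat.ofHom e.symm.toLinearMap)
    (by ext x; simp) hB

lemma V_of_ext {N : ModuleCat.{u} R} {i : ℕ}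
    (h : ∀ s (x : Abelian.Ext (ModuleCat.of R (R ⧸ a ^ s)) N i), x = 0) : V a i N :=
  fun s x => ⟨s, le_rfl, by rw [h s x, Ext.comp_zero]⟩

lemma V_subsingleton {N : Type u} [AddCommGroup N] [Module R N] [Subsingleton N] (i : ℕ) :
    V a i (ModuleCat.of R N) := by
  apply V_of_ext
  intro s x
  have : 𝟙 (ModuleCat.of R N) = 0 := by
    ext x; exact Subsingleton.elim _ _
  rw [← Ext.comp_mk₀_id x, this, Ext.mk₀_zero, Ext.comp_zero]

lemma V_inj {N : ModuleCat.{u} R} [Injective N] (i : ℕ) : V a (i+1) N :=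
  V_of_ext a fun _ x => Ext.eq_zero_of_injective x

lemma V_bij {N : Type u} [AddCommGroup N] [Module R N] (x : R) (hx : x ∈ a)
    (h : Function.Bijective (fun n : N => x • n)) (i : ℕ) : V a i (ModuleCat.of R N) := by
  apply V_of_ext
  intro s y
  have hm : x ^ s ∈ Module.annihilator R (ModuleCat.of R (R ⧸ a ^ s)) := by
    change x ^ s ∈ Module.annihilator R (R ⧸ a ^ s)
    rw [Ideal.annihilator_quotient]
    exact Ideal.pow_mem_pow hx s
  have h0 := Ext.postcomp_smul_id_eq_zero_of_mem_annihilator (M := ModuleCat.of R N) hm i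
  have h0' : y.comp (Ext.mk₀ (x ^ s • 𝟙 (ModuleCat.of R N))) (add_zero _) = 0 :=
    congrArg (fun f => f.hom y) h0
  have hb : Function.Bijective (fun n : N => x ^ s • n) := by
    have := h.iterate s
    rwa [smul_iterate] at this
  have : IsIso (x ^ s • 𝟙 (ModuleCat.of R N)) := by
    rw [ConcreteCategory.isIso_iff_bijective]
    exact hb
  have e : (y.comp (Ext.mk₀ (x ^ s • 𝟙 (ModuleCat.of R N))) (add_zero _)).comp
      (Ext.mk₀ (inv (x ^ s • 𝟙 (ModuleCat.of R N)))) (add_zero _) = y := by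
    rw [Ext.comp_assoc _ _ _ _ (add_zero 0) (by lia), Ext.mk₀_comp_mk₀, IsIso.hom_inv_id,
      Ext.comp_mk₀_id]
  rw [← e, h0', Ext.zero_comp]

/-- hom out of the cyclic module -/
def q {N : Type u} [AddCommGroup N] [Module R N] (s : ℕ) (c : N) (hc : ∀ r ∈ a ^ s, r • c = 0) :
    ModuleCat.of R (R ⧸ a ^ s) ⟶ ModuleCat.of R N :=
  ModuleCat.ofHom (Submodule.liftQ _ (LinearMap.toSpanSingleton R N c) (fun r hr => hc r hr))

lemma q_one {N : Type u} [AddCommGroup N] [Module R N] (s : ℕ) (c : N)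
    (hc : ∀ r ∈ a ^ s, r • c = 0) : (q a s c hc).hom (Submodule.Quotient.mk 1) = c := by
  change (1:R) • c = c
  exact one_smul _ _

lemma exists_q {N : Type u} [AddCommGroup N] [Module R N] (s : ℕ)
    (x : Abelian.Ext (ModuleCat.of R (R ⧸ a ^ s)) (ModuleCat.of R N) 0) :
    ∃ c hc, x = Ext.mk₀ (q (N := N) a s c hc) := by
  obtain ⟨f, rfl⟩ := Ext.addEquiv₀.symm.surjective x
  have hc : ∀ r ∈ a ^ s, r • (f.hom (Submodule.Quotient.mk 1)) = 0 := by
    intro r hr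
    have h1 : r • (Submodule.Quotient.mk 1 : R ⧸ a ^ s) = 0 := by
      rw [← Submodule.Quotient.mk_smul, Submodule.Quotient.mk_eq_zero]; simpa
    have h2 := f.hom.map_smul r (Submodule.Quotient.mk 1 : R ⧸ a ^ s)
    rw [← h2, h1, map_zero]
  refine ⟨f.hom (Submodule.Quotient.mk 1), hc, ?_⟩
  change Ext.mk₀ f = _
  congr 1
  apply ModuleCat.hom_ext
  apply Submodule.linearMap_qext
  apply LinearMap.ext_ring
  simp [q]

lemma q_comp {N N' : Type u} [AddCommGroup N] [Module R N] [AddCommGroup N'] [Module R N']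
    (f : N →ₗ[R] N') (s : ℕ) (c : N) (hc) (c' : N') (hc') (h : f c = c') :
    q a s c hc ≫ ModuleCat.ofHom f = q a s c' hc' := by
  apply ModuleCat.hom_ext
  apply Submodule.linearMap_qext
  apply LinearMap.ext_ring
  change f ((1:R) • c) = (1:R) • c'
  simp [h]

lemma tr_q {N : Type u} [AddCommGroup N] [Module R N] {s t : ℕ} (h : s ≤ t) (c : N) (hc) :
    tr a h ≫ q a s c hc = q a t c (fun r hr => hc r (Ideal.pow_le_pow_right h hr)) := by
  apply ModuleCat.hom_ext
  apply Submodule.linearMap_qext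
  apply LinearMap.ext_ring
  rfl

lemma q_inj {N : Type u} [AddCommGroup N] [Module R N] {s : ℕ} (c c' : N) (hc hc')
    (h : q a s c hc = q a s c' hc') : c = c' := by
  have := congrArg (fun f => f.hom (Submodule.Quotient.mk 1 : R ⧸ a ^ s)) h
  exact (q_one a s c hc).symm.trans (this.trans (q_one a s c' hc'))

lemma V_zero_iff {N : Type u} [AddCommGroup N] [Module R N] : V a 0 (ModuleCat.of R N) ↔
    ∀ s (n : N), (∀ r ∈ a ^ s, r • n = 0) → n = 0 := by
  constructor
  · intro h s n hn
    obtain ⟨t, ht, hx⟩ := h s (Ext.mk₀ (q a s n hn))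
    rw [Ext.mk₀_comp_mk₀, tr_q] at hx
    have h0 := (Ext.mk₀_eq_zero_iff _).1 hx
    have := congrArg (fun f => f.hom (Submodule.Quotient.mk 1 : R ⧸ a ^ t)) h0
    exact (q_one a t n _).symm.trans this
  · intro h
    apply V_of_ext
    intro s x
    obtain ⟨c, hc, rfl⟩ := exists_q a s x
    have : c = 0 := h s c hc
    subst this
    rw [Ext.mk₀_eq_zero_iff]
    apply ModuleCat.hom_ext
    apply Submodule.linearMap_qext
    apply LinearMap.ext_ring
    change (1:R) • (0:N) = 0
    simp

lemma V_one_iff {A B C : Type u} [AddCommGroup A] [AddCommGroup B] [AddCommGroup C] [Module R A]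
    [Module R B] [Module R C] (f : A →ₗ[R] B) (g : B →ₗ[R] C) (hf : Function.Injective f)
    (hg : Function.Surjective g) (h : Function.Exact f g) (hB : V a 1 (ModuleCat.of R B)) :
    V a 1 (ModuleCat.of R A) ↔ ∀ s (c : C), (∀ r ∈ a ^ s, r • c = 0) →
      ∃ t, ∃ e : B, g e = c ∧ ∀ r ∈ a ^ t, r • e = 0 := by
  have hS := ses f g hf hg h
  constructor
  · intro h s c hc
    obtain ⟨t, ht, hx⟩ := h s ((Ext.mk₀ (q a s c hc)).comp hS.extClass rfl)
    change pull a _ _ = 0 at hx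
    rw [pull_comp] at hx
    obtain ⟨y, hy⟩ := Ext.covariant_sequence_exact₃ _ hS _ rfl hx
    obtain ⟨e, he, rfl⟩ := exists_q a t y
    refine ⟨t, e, ?_, he⟩
    dsimp only [pull] at hy
    rw [Ext.mk₀_comp_mk₀, Ext.mk₀_comp_mk₀, tr_q] at hy
    have hy' := (Ext.mk₀_bijective _ _).1 hy
    rw [q_comp a g t e he (g e) (fun r hr => by rw [← map_smul, he r hr, map_zero]) rfl] at hy'
    exact q_inj a _ _ _ _ hy'
  · intro h s x
    obtain ⟨t, ht, hx⟩ := hB s (x.comp (Ext.mk₀ (ModuleCat.ofHom f)) (add_zero _))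
    change pull a _ _ = 0 at hx
    rw [pull_comp] at hx
    obtain ⟨y, hy⟩ := Ext.covariant_sequence_exact₁ _ hS _ hx (zero_add 1)
    obtain ⟨c, hc, rfl⟩ := exists_q a t y
    obtain ⟨w, e, rfl, he⟩ := h t c hc
    refine ⟨max t w, ht.trans (le_max_left _ _), ?_⟩
    change pull a _ _ = 0
    rw [← pull_pull a ht (le_max_left _ _), ← hy, pull_comp]
    dsimp only [pull]
    rw [Ext.mk₀_comp_mk₀, tr_q, ← q_comp a g (max t w) e
      (fun r hr => he r (Ideal.pow_le_pow_right (le_max_right _ _) hr)) (g e) _ rfl,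
      ← Ext.mk₀_comp_mk₀, Ext.comp_assoc _ _ _ _ (zero_add 1) (by lia)]
    have := hS.comp_extClass
    dsimp at this
    rw [this, Ext.comp_zero]

lemma V_succ_iff {A B C : Type u} [AddCommGroup A] [AddCommGroup B] [AddCommGroup C] [Module R A]
    [Module R B] [Module R C] (f : A →ₗ[R] B) (g : B →ₗ[R] C) (hf : Function.Injective f)
    (hg : Function.Surjective g) (h : Function.Exact f g) (i : ℕ)
    (hB : ∀ i, V a (i+1) (ModuleCat.of R B)) :
    V a (i+2) (ModuleCat.of R A) ↔ V a (i+1) (ModuleCat.of R C) := by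
  have hS := ses f g hf hg h
  exact ⟨fun h => V_right a hS (hB i) h, fun h => V_left a hS h (hB (i+1))⟩
end Br

namespace Br
section gam
variable {T : Type u} [CommRing T]

lemma unif (b : Ideal T) {P Q : Type u} [AddCommGroup P] [Module T P] [AddCommGroup Q] [Module T Q]
    [Module.Finite T P] (g : P →ₗ[T] Q) (h : ∀ p, ∃ k, ∀ r ∈ b ^ k, r • g p = 0) :
    ∃ k, ∀ p, ∀ r ∈ b ^ k, r • g p = 0 := by
  obtain ⟨S, hS⟩ := Module.Finite.fg_top (R := T) (M := P)
  choose k hk using h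
  refine ⟨S.sup k, fun p => ?_⟩
  have hp : p ∈ Submodule.span T (S : Set P) := by rw [hS]; trivial
  induction hp using Submodule.span_induction with
  | mem x hx =>
    intro r hr
    exact hk x r (Ideal.pow_le_pow_right (Finset.le_sup hx) hr)
  | zero => simp
  | add x y _ _ hx hy =>
    intro r hr
    rw [map_add, smul_add, hx r hr, hy r hr, add_zero]
  | smul c x _ hx =>
    intro r hr
    rw [map_smul, smul_comm, hx r hr, smul_zero]

/-- the torsion submodule with respect to the powers of an ideal -/
def Gam (b : Ideal T) (E : Type u) [AddCommGroup E] [Module T E] : Submodule T E where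
  carrier := {e | ∃ k, ∀ r ∈ b ^ k, r • e = 0}
  zero_mem' := ⟨0, by simp⟩
  add_mem' := by
    rintro x y ⟨k, hk⟩ ⟨l, hl⟩
    refine ⟨max k l, fun r hr => ?_⟩
    rw [smul_add, hk r (Ideal.pow_le_pow_right (le_max_left _ _) hr),
      hl r (Ideal.pow_le_pow_right (le_max_right _ _) hr), add_zero]
  smul_mem' := by
    rintro c x ⟨k, hk⟩
    refine ⟨k, fun r hr => ?_⟩
    rw [smul_comm, hk r hr, smul_zero]

variable (b : Ideal T) {E : Type u} [AddCommGroup E] [Module T E]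

lemma mem_Gam {e : E} : e ∈ Gam b E ↔ ∃ k, ∀ r ∈ b ^ k, r • e = 0 := Iff.rfl

lemma Gam_inj [IsNoetherianRing T] (hE : Module.Injective T E) : Module.Injective T (Gam b E) := by
  apply Module.Baer.injective
  intro I g
  obtain ⟨n, hn⟩ := unif b ((Gam b E).subtype ∘ₗ g) (fun p => (g p).2)
  obtain ⟨k, hk⟩ := Ideal.exists_pow_inf_eq_pow_smul b I
  set m := k + n
  have hm : b ^ m ⊓ I ≤ b ^ n • I := by
    have := hk m (by lia)
    simp only [smul_eq_mul, Ideal.mul_top] at this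
    rw [this, show m - k = n by lia]
    exact Submodule.smul_mono le_rfl inf_le_right
  have hv : ∀ x : I, (x : T) ∈ b ^ n • I → g x = 0 := by
    rintro ⟨x, hx⟩ hx'
    simp only at hx'
    have key : ∃ hx, g ⟨x, hx⟩ = 0 := by
      refine Submodule.smul_induction_on (p := fun x => ∃ hx, g ⟨x, hx⟩ = 0) hx' ?_ ?_
      · intro r hr y hy
        refine ⟨I.mul_mem_left r hy, ?_⟩
        have := hn ⟨y, hy⟩ r hr
        apply Subtype.ext
        change ((g (r • ⟨y, hy⟩) : Gam b E) : E) = 0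
        rw [map_smul]
        exact this
      · rintro x y ⟨h1, h1'⟩ ⟨h2, h2'⟩
        refine ⟨I.add_mem h1 h2, ?_⟩
        change g (⟨x, h1⟩ + ⟨y, h2⟩) = 0
        rw [map_add, h1', h2', add_zero]
    exact key.2
  let i := Submodule.mapQ (Submodule.comap I.subtype (b ^ m)) (b ^ m) I.subtype le_rfl
  have hi : Function.Injective i := by
    rw [← LinearMap.ker_eq_bot, LinearMap.ker_eq_bot']
    intro x hx
    obtain ⟨x, rfl⟩ := Submodule.Quotient.mk_surjective _ x
    rw [Submodule.mapQ_apply, Submodule.Quotient.mk_eq_zero] at hx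
    rw [Submodule.Quotient.mk_eq_zero]
    exact hx
  let f := Submodule.liftQ (Submodule.comap I.subtype (b ^ m)) ((Gam b E).subtype ∘ₗ g) (by
    intro x hx
    have := hv x (hm ⟨hx, x.2⟩)
    simp [this])
  obtain ⟨h, hh⟩ := (Module.Baer.of_injective hE).extension_property i hi f
  have hG : ∀ y, h y ∈ Gam b E := by
    intro y
    refine ⟨m, fun r hr => ?_⟩
    rw [← map_smul]
    have : r • y = 0 := by
      obtain ⟨y, rfl⟩ := Submodule.Quotient.mk_surjective _ y
      rw [← Submodule.Quotient.mk_smul, Submodule.Quotient.mk_eq_zero]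
      exact Ideal.mul_mem_right _ _ hr
    rw [this, map_zero]
  refine ⟨(h.codRestrict _ hG) ∘ₗ Submodule.mkQ _, fun x hx => ?_⟩
  apply Subtype.ext
  exact LinearMap.congr_fun hh (Submodule.Quotient.mk ⟨x, hx⟩)

lemma exists_inj (N : Type u) [AddCommGroup N] [Module T N] : ∃ (E : Type u) (_ : AddCommGroup E)
    (_ : Module T E) (f : N →ₗ[T] E), Module.Injective T E ∧ Function.Injective f := by
  let N' : ModuleCat.{u} T := ModuleCat.of T N
  let E : ModuleCat.{u} T := Injective.under N'
  refine ⟨E, inferInstance, inferInstance, (Injective.ι N').hom, ?_, ?_⟩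
  · have : Injective (ModuleCat.of T E) :=
      inferInstanceAs (Injective (Injective.under N'))
    exact Module.injective_module_of_injective_object _ _
  · exact (ModuleCat.mono_iff_injective _).1 inferInstance

/-- torsion modules -/
def Tors (b : Ideal T) (N : Type u) [AddCommGroup N] [Module T N] : Prop :=
  ∀ n : N, ∃ k, ∀ r ∈ b ^ k, r • n = 0

lemma Tors_Gam : Tors b (Gam b E) := by
  rintro ⟨n, k, hk⟩
  exact ⟨k, fun r hr => Subtype.ext (hk r hr)⟩

lemma Tors.surj {b : Ideal T} {N N' : Type u} [AddCommGroup N] [Module T N] [AddCommGroup N'] [Module T N']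
    (h : Tors b N) (f : N →ₗ[T] N') (hf : Function.Surjective f) : Tors b N' := by
  intro n
  obtain ⟨n, rfl⟩ := hf n
  obtain ⟨k, hk⟩ := h n
  exact ⟨k, fun r hr => by rw [← map_smul, hk r hr, map_zero]⟩

lemma Tors.inj {b : Ideal T} {N N' : Type u} [AddCommGroup N] [Module T N] [AddCommGroup N'] [Module T N']
    (h : Tors b N') (f : N →ₗ[T] N') (hf : Function.Injective f) : Tors b N := by
  intro n
  obtain ⟨k, hk⟩ := h (f n)
  exact ⟨k, fun r hr => hf (by rw [map_smul, hk r hr, map_zero])⟩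

lemma Tors.sup {b c : Ideal T} {N : Type u} [AddCommGroup N] [Module T N]
    (h : Tors b N) (h' : Tors c N) : Tors (b ⊔ c) N := by
  intro n
  obtain ⟨k, hk⟩ := h n
  obtain ⟨l, hl⟩ := h' n
  refine ⟨k + l, fun r hr => ?_⟩
  obtain ⟨x, hx, y, hy, rfl⟩ := Submodule.mem_sup.1 (Ideal.sup_pow_add_le_pow_sup_pow hr)
  rw [add_smul, hk x hx, hl y hy, add_zero]

lemma V_tors [IsNoetherianRing T] (i : ℕ) : ∀ (N : Type u) [AddCommGroup N] [Module T N], Tors b N →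
    V b (i+1) (ModuleCat.of T N) := by
  induction i with
  | zero =>
    intro N _ _ hN
    obtain ⟨E, _, _, f, hE, hf⟩ := exists_inj (T := T) N
    have := Module.injective_object_of_injective_module (R := T) (M := Gam b E) (inj := Gam_inj b hE)
    let f' : N →ₗ[T] Gam b E := f.codRestrict _ (fun n => by
      obtain ⟨k, hk⟩ := hN n
      exact ⟨k, fun r hr => by rw [← map_smul, hk r hr, map_zero]⟩)
    have hf' : Function.Injective f' := fun x y h => hf (congrArg Subtype.val h)
    rw [zero_add, V_one_iff b f' (LinearMap.range f').mkQ hf' (Submodule.mkQ_surjective _)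
      (LinearMap.exact_map_mkQ_range f') (V_inj b 0)]
    intro s c _
    obtain ⟨e, rfl⟩ := Submodule.mkQ_surjective _ c
    obtain ⟨k, hk⟩ := Tors_Gam b e
    exact ⟨k, e, rfl, hk⟩
  | succ i ih =>
    intro N _ _ hN
    obtain ⟨E, _, _, f, hE, hf⟩ := exists_inj (T := T) N
    have := Module.injective_object_of_injective_module (R := T) (M := Gam b E) (inj := Gam_inj b hE)
    let f' : N →ₗ[T] Gam b E := f.codRestrict _ (fun n => by
      obtain ⟨k, hk⟩ := hN n
      exact ⟨k, fun r hr => by rw [← map_smul, hk r hr, map_zero]⟩)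
    have hf' : Function.Injective f' := fun x y h => hf (congrArg Subtype.val h)
    change V b (i+2) _
    rw [V_succ_iff b f' (LinearMap.range f').mkQ hf' (Submodule.mkQ_surjective _)
      (LinearMap.exact_map_mkQ_range f') i (fun i => V_inj b i)]
    exact ih _ ((Tors_Gam b).surj _ (Submodule.mkQ_surjective _))

end gam
end Br

namespace Br
section bd
variable {R : Type u} [CommRing R]

lemma tors_span {N : Type u} [AddCommGroup N] [Module R N] (x : R)
    (h : ∀ n : N, ∃ k : ℕ, x ^ k • n = 0) : Tors (Ideal.span {x}) N := by
  intro n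
  obtain ⟨k, hk⟩ := h n
  refine ⟨k, fun r hr => ?_⟩
  rw [Ideal.span_singleton_pow] at hr
  obtain ⟨y, rfl⟩ := Ideal.mem_span_singleton'.1 hr
  rw [mul_smul, hk, smul_zero]

lemma tors_bot {N : Type u} [AddCommGroup N] [Module R N] : Tors (⊥ : Ideal R) N := by
  intro n
  refine ⟨1, fun r hr => ?_⟩
  rw [pow_one] at hr
  rw [(Submodule.mem_bot R).1 hr, zero_smul]

lemma ideal_cons (a b : Ideal R) (x : R) (xs : List R)
    (h : b ⊔ Ideal.span {y | y ∈ x :: xs} = a) :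
    (b ⊔ Ideal.span {x}) ⊔ Ideal.span {y | y ∈ xs} = a ∧ x ∈ a := by
  have : {y | y ∈ x :: xs} = {x} ∪ {y | y ∈ xs} := by
    ext y; simp
  constructor
  · rw [sup_assoc, ← Ideal.span_union, ← this, h]
  · rw [← h]
    exact Ideal.mem_sup_right (Ideal.subset_span (by simp))

lemma V_bound_aux [IsNoetherianRing R] (a : Ideal R) : ∀ (xs : List R) (b : Ideal R),
    b ⊔ Ideal.span {y | y ∈ xs} = a → ∀ (N : Type u) [AddCommGroup N] [Module R N],
    Tors b N → ∀ i, xs.length < i → V a i (ModuleCat.of R N) := by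
  intro xs
  induction xs with
  | nil =>
    intro b hb N _ _ hN i hi
    simp at hb hi
    subst hb
    obtain ⟨i, rfl⟩ : ∃ j, i = j + 1 := ⟨i - 1, by lia⟩
    exact V_tors b i N hN
  | cons x xs ih =>
    intro b hb N _ _ hN i hi
    obtain ⟨hb', hx⟩ := ideal_cons a b x xs hb
    obtain ⟨i, rfl⟩ : ∃ j, i = j + 1 := ⟨i - 1, by lia⟩
    simp only [List.length_cons, add_lt_add_iff_right] at hi
    let L := LocalizedModule (Submonoid.powers x) N
    let f : N →ₗ[R] L := LocalizedModule.mkLinearMap (Submonoid.powers x) N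
    have hL : Tors b L := by
      intro l
      induction l using LocalizedModule.induction_on with
      | h m s =>
        obtain ⟨k, hk⟩ := hN m
        refine ⟨k, fun r hr => ?_⟩
        rw [LocalizedModule.smul'_mk, hk r hr, LocalizedModule.zero_mk]
    have hbij : Function.Bijective (fun l : L => x • l) := by
      have := IsLocalizedModule.map_units f (⟨x, Submonoid.mem_powers x⟩ : Submonoid.powers x)
      rw [Module.End.isUnit_iff] at this
      exact this
    have hK : V a (i+1) (ModuleCat.of R (LinearMap.ker f)) := by
      refine ih _ hb' _ (Tors.sup (hN.inj (LinearMap.ker f).subtype Subtype.val_injective)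
        (tors_span x ?_)) _ (by lia)
      rintro ⟨n, hn⟩
      obtain ⟨⟨_, k, rfl⟩, hk⟩ := (IsLocalizedModule.eq_zero_iff (Submonoid.powers x) f).1 hn
      exact ⟨k, Subtype.ext hk⟩
    have hC : V a i (ModuleCat.of R (L ⧸ LinearMap.range f)) := by
      refine ih _ hb' _ (Tors.sup (hL.surj (LinearMap.range f).mkQ (Submodule.mkQ_surjective _))
        (tors_span x ?_)) _ (by lia)
      intro l
      obtain ⟨l, rfl⟩ := Submodule.mkQ_surjective _ l
      obtain ⟨⟨m, ⟨_, k, rfl⟩⟩, hk⟩ := IsLocalizedModule.surj (Submonoid.powers x) f l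
      refine ⟨k, ?_⟩
      rw [← map_smul, Submodule.mkQ_apply, Submodule.Quotient.mk_eq_zero]
      exact ⟨m, hk.symm⟩
    have h1 : V a (i+1) (ModuleCat.of R (LinearMap.range f)) :=
      V_left a (ses (LinearMap.range f).subtype (LinearMap.range f).mkQ Subtype.val_injective
        (Submodule.mkQ_surjective _) (LinearMap.exact_subtype_mkQ _)) hC (V_bij a x hx hbij _)
    exact V_mid a (ses (LinearMap.ker f).subtype f.rangeRestrict Subtype.val_injective
        f.surjective_rangeRestrict (by
          intro n
          simp [LinearMap.rangeRestrict, Subtype.ext_iff])) hK h1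

lemma exists_list [IsNoetherianRing R] (a : Ideal R) : ∃ xs : List R,
    ⊥ ⊔ Ideal.span {y | y ∈ xs} = a := by
  obtain ⟨S, hS⟩ := (isNoetherianRing_iff_ideal_fg R).1 inferInstance a
  refine ⟨S.toList, ?_⟩
  rw [← hS]
  simp

lemma V_bound [IsNoetherianRing R] (a : Ideal R) : ∃ n, ∀ (N : Type u) [AddCommGroup N] [Module R N],
    ∀ i, n < i → V a i (ModuleCat.of R N) := by
  obtain ⟨xs, hxs⟩ := exists_list a
  exact ⟨xs.length, fun N _ _ i hi => V_bound_aux a xs ⊥ hxs N tors_bot i hi⟩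

variable {T : Type u} [CommRing T] [Algebra R T]

lemma V_mid_res (a : Ideal R) {A B C : Type u} [AddCommGroup A] [AddCommGroup B] [AddCommGroup C]
    [Module R A] [Module R B] [Module R C] [Module T A] [Module T B] [Module T C]
    [IsScalarTower R T A] [IsScalarTower R T B] [IsScalarTower R T C]
    (f : A →ₗ[T] B) (g : B →ₗ[T] C) (hf : Function.Injective f)
    (hg : Function.Surjective g) (h : Function.Exact f g) (i : ℕ)
    (hA : V a i (ModuleCat.of R A)) (hC : V a i (ModuleCat.of R C)) : V a i (ModuleCat.of R B) :=
  V_mid a (ses (f.restrictScalars R) (g.restrictScalars R) hf hg h) hA hC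

lemma V_one_iff_res (a : Ideal R) {A B C : Type u} [AddCommGroup A] [AddCommGroup B] [AddCommGroup C]
    [Module R A] [Module R B] [Module R C] [Module T A] [Module T B] [Module T C]
    [IsScalarTower R T A] [IsScalarTower R T B] [IsScalarTower R T C]
    (f : A →ₗ[T] B) (g : B →ₗ[T] C) (hf : Function.Injective f)
    (hg : Function.Surjective g) (h : Function.Exact f g) (hB : V a 1 (ModuleCat.of R B)) :
    V a 1 (ModuleCat.of R A) ↔ ∀ s (c : C), (∀ r ∈ a ^ s, r • c = 0) →
      ∃ t, ∃ e : B, g e = c ∧ ∀ r ∈ a ^ t, r • e = 0 :=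
  V_one_iff a (f.restrictScalars R) (g.restrictScalars R) hf hg h hB

lemma V_succ_iff_res (a : Ideal R) {A B C : Type u} [AddCommGroup A] [AddCommGroup B] [AddCommGroup C]
    [Module R A] [Module R B] [Module R C] [Module T A] [Module T B] [Module T C]
    [IsScalarTower R T A] [IsScalarTower R T B] [IsScalarTower R T C]
    (f : A →ₗ[T] B) (g : B →ₗ[T] C) (hf : Function.Injective f)
    (hg : Function.Surjective g) (h : Function.Exact f g) (i : ℕ) (hB : ∀ i, V a (i+1) (ModuleCat.of R B)) :
    V a (i+2) (ModuleCat.of R A) ↔ V a (i+1) (ModuleCat.of R C) :=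
  V_succ_iff a (f.restrictScalars R) (g.restrictScalars R) hf hg h i hB

lemma V_Tinj_aux [IsNoetherianRing R] [IsNoetherianRing T] (a : Ideal R) : ∀ (xs : List R) (b : Ideal R),
    b ⊔ Ideal.span {y | y ∈ xs} = a → ∀ (N : Type u) [AddCommGroup N] [Module R N]
    [Module T N] [IsScalarTower R T N],
    Tors b N → Module.Injective T N → ∀ i, V a (i+1) (ModuleCat.of R N) := by
  intro xs
  induction xs with
  | nil =>
    intro b hb N _ _ _ _ hN _ i
    simp at hb
    subst hb
    exact V_tors b i N hN
  | cons x xs ih =>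
    intro b hb N _ _ _ _ hN hinj i
    obtain ⟨hb', hx⟩ := ideal_cons a b x xs hb
    set y := algebraMap R T x with hy
    have hxy : ∀ (k : ℕ) (n : N), x ^ k • n = y ^ k • n := fun k n => by
      rw [hy, ← map_pow, algebraMap_smul]
    let G := Gam (Ideal.span {y}) N
    have hGm : ∀ n : N, n ∈ G ↔ ∃ k : ℕ, y ^ k • n = 0 := by
      intro n
      constructor
      · rintro ⟨k, hk⟩
        exact ⟨k, hk _ (Ideal.pow_mem_pow (Ideal.mem_span_singleton_self y) k)⟩
      · rintro ⟨k, hk⟩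
        refine ⟨k, fun r hr => ?_⟩
        rw [Ideal.span_singleton_pow] at hr
        obtain ⟨z, rfl⟩ := Ideal.mem_span_singleton'.1 hr
        rw [mul_smul, hk, smul_zero]
    have hGi : Module.Injective T G := Gam_inj _ hinj
    have hG : V a (i+1) (ModuleCat.of R G) := by
      refine ih _ hb' _ (Tors.sup (hN.inj (G.subtype.restrictScalars R) Subtype.val_injective)
        (tors_span x ?_)) hGi i
      rintro ⟨n, hn⟩
      obtain ⟨k, hk⟩ := (hGm n).1 hn
      refine ⟨k, Subtype.ext ?_⟩
      rw [← hxy] at hk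
      exact hk
    have hQ : V a (i+1) (ModuleCat.of R (N ⧸ G)) := by
      refine V_bij a x hx ⟨?_, ?_⟩ _
      · have : Function.Injective (LinearMap.lsmul R (N ⧸ G) x) := by
          rw [← LinearMap.ker_eq_bot, LinearMap.ker_eq_bot']
          intro n hn
          obtain ⟨n, rfl⟩ := Submodule.mkQ_surjective _ n
          change Submodule.Quotient.mk (x • n) = 0 at hn
          rw [Submodule.Quotient.mk_eq_zero, hGm] at hn
          obtain ⟨k, hk⟩ := hn
          rw [Submodule.mkQ_apply, Submodule.Quotient.mk_eq_zero, hGm]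
          refine ⟨k + 1, ?_⟩
          rw [pow_succ, mul_smul, ← pow_one y, ← hxy, pow_one, pow_one, hk]
        exact this
      · intro n
        obtain ⟨n, rfl⟩ := Submodule.mkQ_surjective _ n
        obtain ⟨p, hp⟩ := hGi.out G.subtype Subtype.val_injective LinearMap.id
        let n' : N := n - p n
        have hpn : p n' = 0 := by
          have := hp (p n)
          simp only [Submodule.subtype_apply, LinearMap.id_apply] at this
          rw [map_sub, this, sub_self]
        let m : T →ₗ[T] T := LinearMap.mulLeft T y
        let j := (LinearMap.ker m).liftQ m le_rfl
        have hj : Function.Injective j := by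
          rw [← LinearMap.ker_eq_bot]
          exact Submodule.ker_liftQ_eq_bot _ _ _ le_rfl
        let f := (LinearMap.ker m).liftQ (LinearMap.toSpanSingleton T N n') (by
          intro t ht
          have ht' : y * t = 0 := ht
          have h1 : t • n' ∈ G := (hGm _).2 ⟨1, by rw [pow_one, ← mul_smul, ht', zero_smul]⟩
          have h2 := hp ⟨_, h1⟩
          simp only [Submodule.subtype_apply, LinearMap.id_apply, map_smul, hpn, smul_zero] at h2
          exact (congrArg Subtype.val h2).symm)
        obtain ⟨h, hh⟩ := hinj.out j hj f
        have h3 := hh (Submodule.Quotient.mk 1)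
        change h (y * 1) = (1:T) • n' at h3
        rw [one_smul, ← smul_eq_mul, map_smul] at h3
        refine ⟨Submodule.Quotient.mk (h 1), ?_⟩
        change Submodule.Quotient.mk (x • h 1) = Submodule.Quotient.mk n
        rw [← pow_one x, hxy, pow_one, h3, Submodule.Quotient.eq]
        simp [n']
    exact V_mid_res a G.subtype G.mkQ Subtype.val_injective (Submodule.mkQ_surjective _)
      (LinearMap.exact_subtype_mkQ G) (i+1) hG hQ

lemma V_Tinj [IsNoetherianRing R] [IsNoetherianRing T] (a : Ideal R) (N : Type u) [AddCommGroup N]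
    [Module R N] [Module T N] [IsScalarTower R T N] (h : Module.Injective T N) (i : ℕ) :
    V a (i+1) (ModuleCat.of R N) := by
  obtain ⟨xs, hxs⟩ := exists_list a
  exact V_Tinj_aux (T := T) a xs ⊥ hxs N tors_bot h i

lemma kill_iff (a : Ideal R) {N : Type u} [AddCommGroup N]
    [Module R N] [Module T N] [IsScalarTower R T N] (s : ℕ) (n : N) :
    (∀ r ∈ (a.map (algebraMap R T)) ^ s, r • n = 0) ↔ ∀ r ∈ a ^ s, r • n = 0 := by
  rw [← Ideal.map_pow]
  constructor
  · intro h r hr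
    rw [← algebraMap_smul T]
    exact h _ (Ideal.mem_map_of_mem _ hr)
  · intro h r hr
    have : (a ^ s).map (algebraMap R T) ≤ LinearMap.ker (LinearMap.toSpanSingleton T N n) := by
      rw [Ideal.map_le_iff_le_comap]
      intro z hz
      change algebraMap R T z • n = 0
      rw [algebraMap_smul, h z hz]
    exact this hr

lemma indep_zero (a : Ideal R) (N : Type u) [AddCommGroup N]
    [Module R N] [Module T N] [IsScalarTower R T N] :
    V (a.map (algebraMap R T)) 0 (ModuleCat.of T N) ↔ V a 0 (ModuleCat.of R N) := by
  rw [V_zero_iff, V_zero_iff]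
  simp only [kill_iff]

lemma indep_succ [IsNoetherianRing R] [IsNoetherianRing T] (a : Ideal R) (i : ℕ) : ∀ (N : Type u)
    [AddCommGroup N] [Module R N] [Module T N] [IsScalarTower R T N],
    V (a.map (algebraMap R T)) (i+1) (ModuleCat.of T N) ↔ V a (i+1) (ModuleCat.of R N) := by
  induction i with
  | zero =>
    intro N _ _ _ _
    obtain ⟨E, _, _, f, hE, hf⟩ := exists_inj (T := T) N
    let _ : Module R E := Module.compHom E (algebraMap R T)
    have : IsScalarTower R T E := IsScalarTower.of_algebraMap_smul (fun _ _ => rfl)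
    have := Module.injective_object_of_injective_module (R := T) (M := E)
    rw [zero_add, V_one_iff _ f (LinearMap.range f).mkQ hf (Submodule.mkQ_surjective _)
      (LinearMap.exact_map_mkQ_range f) (V_inj _ 0),
      V_one_iff_res a f (LinearMap.range f).mkQ hf
      (Submodule.mkQ_surjective _) (LinearMap.exact_map_mkQ_range f) (V_Tinj (T := T) a E hE 0)]
    simp only [kill_iff]
  | succ i ih =>
    intro N _ _ _ _
    obtain ⟨E, _, _, f, hE, hf⟩ := exists_inj (T := T) N
    let _ : Module R E := Module.compHom E (algebraMap R T)
    have : IsScalarTower R T E := IsScalarTower.of_algebraMap_smul (fun _ _ => rfl)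
    have := Module.injective_object_of_injective_module (R := T) (M := E)
    change V _ (i+2) _ ↔ V _ (i+2) _
    rw [V_succ_iff _ f (LinearMap.range f).mkQ hf (Submodule.mkQ_surjective _)
      (LinearMap.exact_map_mkQ_range f) i (fun i => V_inj _ i),
      V_succ_iff_res a f (LinearMap.range f).mkQ hf
      (Submodule.mkQ_surjective _) (LinearMap.exact_map_mkQ_range f) i
        (fun i => V_Tinj (T := T) a E hE i)]
    exact ih _

lemma indep [IsNoetherianRing R] [IsNoetherianRing T] (a : Ideal R) (i : ℕ) (N : Type u)
    [AddCommGroup N] [Module R N] [Module T N] [IsScalarTower R T N] :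
    V (a.map (algebraMap R T)) i (ModuleCat.of T N) ↔ V a i (ModuleCat.of R N) := by
  cases i with
  | zero => exact indep_zero a N
  | succ i => exact indep_succ a i N
end bd
end Br

namespace Br
section gr
variable {R : Type u} [CommRing R]
open Abelian

/-- vanishing of an Ext group -/
def EZ (N : ModuleCat.{u} R) (i : ℕ) (L : Type u) [AddCommGroup L] [Module R L] : Prop :=
  ∀ x : Abelian.Ext (ModuleCat.of R L) N i, x = 0

section
variable (N : ModuleCat.{u} R) {A B C : Type u} [AddCommGroup A] [AddCommGroup B] [AddCommGroup C]
    [Module R A] [Module R B] [Module R C] (f : A →ₗ[R] B) (g : B →ₗ[R] C)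

lemma EZ_mid (hf : Function.Injective f)
    (hg : Function.Surjective g) (h : Function.Exact f g) {i : ℕ} (hA : EZ N i A) (hC : EZ N i C) :
    EZ N i B := by
  intro x
  obtain ⟨y, rfl⟩ := Ext.contravariant_sequence_exact₂ (ses f g hf hg h) _ x (hA _)
  rw [hC y, Ext.comp_zero]

lemma EZ_right (hf : Function.Injective f)
    (hg : Function.Surjective g) (h : Function.Exact f g) {i : ℕ} (hA : EZ N i A) (hB : EZ N (i+1) B) :
    EZ N (i+1) C := by
  intro x
  obtain ⟨y, rfl⟩ := Ext.contravariant_sequence_exact₃ (ses f g hf hg h) _ x (hB _) (add_comm 1 i)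
  rw [hA y, Ext.comp_zero]

lemma EZ_zero (hg : Function.Surjective g) (hB : EZ N 0 B) : EZ N 0 C := by
  intro x
  have : Epi (ModuleCat.ofHom g) := (ModuleCat.epi_iff_surjective _).2 hg
  apply Ext.precomp_mk₀_injective_of_epi N (ModuleCat.ofHom g)
  rw [map_zero]
  exact hB _

lemma EZ_subsingleton [Subsingleton A] (i : ℕ) : EZ N i A := by
  intro x
  have : 𝟙 (ModuleCat.of R A) = 0 := by
    ext x; exact Subsingleton.elim _ _
  rw [← Ext.mk₀_id_comp x, this, Ext.mk₀_zero, Ext.zero_comp]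

lemma exact_fin (m : ℕ) :
    Function.Injective (LinearMap.single R (fun _ : Fin (m+1) => A) 0) ∧
    Function.Surjective (LinearMap.funLeft R A (Fin.succ : Fin m → Fin (m+1))) ∧
    Function.Exact (LinearMap.single R (fun _ : Fin (m+1) => A) 0)
      (LinearMap.funLeft R A (Fin.succ : Fin m → Fin (m+1))) := by
  refine ⟨Pi.single_injective (M := fun _ : Fin (m+1) => A) 0, LinearMap.funLeft_surjective_of_injective _ _ _ (Fin.succ_injective _),
    fun v => ⟨fun h => ⟨v 0, ?_⟩, ?_⟩⟩
  · ext j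
    refine Fin.cases ?_ (fun j => ?_) j
    · simp
    · simpa [LinearMap.funLeft_apply] using (congrFun h j).symm
  · rintro ⟨c, rfl⟩
    ext j
    simp [LinearMap.funLeft_apply]

lemma EZ_fin {i : ℕ} (hA : EZ N i A) (m : ℕ) : EZ N i (Fin m → A) := by
  induction m with
  | zero => exact EZ_subsingleton N i
  | succ m ih =>
    obtain ⟨h1, h2, h3⟩ := exact_fin (R := R) (A := A) m
    exact EZ_mid N _ _ h1 h2 h3 hA ih

lemma V_fin (a : Ideal R) {i : ℕ} (hA : V a i (ModuleCat.of R A)) (m : ℕ) :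
    V a i (ModuleCat.of R (Fin m → A)) := by
  induction m with
  | zero => exact V_subsingleton a i
  | succ m ih =>
    obtain ⟨h1, h2, h3⟩ := exact_fin (R := R) (A := A) m
    exact V_mid a (ses _ _ h1 h2 h3) hA ih
end

variable [IsNoetherianRing R] (a : Ideal R) (N : ModuleCat.{u} R)

lemma EZ_K1 (n : ℕ) (h : ∀ i < n, EZ N i (R ⧸ a)) (i : ℕ) : i < n → ∀ (L : Type u) [AddCommGroup L]
    [Module R L] [Module.Finite R L], (∀ r ∈ a, ∀ l : L, r • l = 0) → EZ N i L := by
  have key : ∀ (L : Type u) [AddCommGroup L] [Module R L] [Module.Finite R L],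
      (∀ r ∈ a, ∀ l : L, r • l = 0) → ∃ (m : ℕ) (f : (Fin m → R ⧸ a) →ₗ[R] L),
        Function.Surjective f := by
    intro L _ _ _ hL
    have ht : Module.IsTorsionBySet R L a := fun l r => hL r r.2 l
    let _ := ht.module
    have : IsScalarTower R (R ⧸ a) L := ht.isScalarTower
    have : Module.Finite (R ⧸ a) L := Module.Finite.of_restrictScalars_finite R _ _
    obtain ⟨m, f, hf⟩ := Module.Finite.exists_fin' (R ⧸ a) L
    exact ⟨m, f.restrictScalars R, hf⟩
  induction i with
  | zero =>
    intro hi L _ _ _ hL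
    obtain ⟨m, f, hf⟩ := key L hL
    exact EZ_zero N f hf (EZ_fin N (h 0 hi) m)
  | succ i ih =>
    intro hi L _ _ _ hL
    obtain ⟨m, f, hf⟩ := key L hL
    refine EZ_right N (LinearMap.ker f).subtype f Subtype.val_injective hf
      (LinearMap.exact_subtype_ker_map f) (ih (by lia) _ ?_) (EZ_fin N (h _ hi) m)
    rintro r hr ⟨l, _⟩
    apply Subtype.ext
    change r • l = 0
    ext j
    obtain ⟨z, hz⟩ := Submodule.Quotient.mk_surjective _ (l j)
    rw [Pi.smul_apply, ← hz, ← Submodule.Quotient.mk_smul, Pi.zero_apply, Submodule.Quotient.mk_eq_zero]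
    exact Ideal.mul_mem_right _ _ hr

lemma EZ_K2 (n : ℕ) (h : ∀ i < n, EZ N i (R ⧸ a)) (i : ℕ) (hi : i < n) (k : ℕ) :
    ∀ (L : Type u) [AddCommGroup L]
    [Module R L] [Module.Finite R L], (∀ r ∈ a ^ k, ∀ l : L, r • l = 0) → EZ N i L := by
  induction k with
  | zero =>
    intro L _ _ _ hL
    have : Subsingleton L := ⟨fun x y => by
      rw [← one_smul R x, ← one_smul R y, hL 1 (by simp), hL 1 (by simp)]⟩
    exact EZ_subsingleton N i
  | succ k ih =>
    intro L _ _ _ hL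
    let P : Submodule R L := a • ⊤
    refine EZ_mid N P.subtype P.mkQ Subtype.val_injective (Submodule.mkQ_surjective _)
      (LinearMap.exact_subtype_mkQ P) (ih _ ?_) (EZ_K1 a N n h i hi _ ?_)
    · rintro r hr ⟨l, hl⟩
      apply Subtype.ext
      change r • l = 0
      refine Submodule.smul_induction_on (p := fun l => r • l = 0) hl ?_ ?_
      · intro s hs l hl
        rw [← mul_smul]
        exact hL _ (by rw [pow_succ]; exact Ideal.mul_mem_mul hr hs) _
      · intro x y hx hy
        rw [smul_add, hx, hy, add_zero]
    · intro r hr l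
      obtain ⟨l, rfl⟩ := Submodule.mkQ_surjective _ l
      rw [← map_smul, Submodule.mkQ_apply, Submodule.Quotient.mk_eq_zero]
      exact Submodule.smul_mem_smul hr trivial

lemma quot_kill (k : ℕ) : ∀ r ∈ a ^ k, ∀ l : R ⧸ a ^ k, r • l = 0 := by
  intro r hr l
  obtain ⟨l, rfl⟩ := Submodule.Quotient.mk_surjective _ l
  rw [← Submodule.Quotient.mk_smul, Submodule.Quotient.mk_eq_zero]
  exact Ideal.mul_mem_right _ _ hr

lemma EZ_V (n : ℕ) : (∀ i < n, EZ N i (R ⧸ a)) ↔ ∀ i < n, V a i N := by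
  constructor
  · intro h i hi
    exact V_of_ext a (fun s => EZ_K2 a N n h i hi s _ (quot_kill a s))
  · intro h i
    induction i using Nat.strong_induction_on with
    | _ i ih =>
    intro hi x
    let p1 : (R ⧸ a ^ 1) →ₗ[R] (R ⧸ a) := Submodule.mapQ _ _ LinearMap.id (by rw [pow_one]; rfl)
    obtain ⟨t, ht, hx⟩ := h i hi 1 ((Ext.mk₀ (ModuleCat.ofHom p1)).comp x (zero_add _))
    rw [Ext.mk₀_comp_mk₀_assoc] at hx
    let p : (R ⧸ a ^ t) →ₗ[R] (R ⧸ a) :=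
      Submodule.mapQ _ _ LinearMap.id (Ideal.pow_le_self (by lia))
    have hp : tr a ht ≫ ModuleCat.ofHom p1 = ModuleCat.ofHom p := by
      apply ModuleCat.hom_ext
      apply LinearMap.ext
      intro x
      obtain ⟨x, rfl⟩ := Submodule.Quotient.mk_surjective _ x
      rfl
    have hps : Function.Surjective p := by
      intro x
      obtain ⟨x, rfl⟩ := Submodule.Quotient.mk_surjective _ x
      exact ⟨Submodule.Quotient.mk x, rfl⟩
    rw [hp] at hx
    cases i with
    | zero =>
      have : Epi (ModuleCat.ofHom p) := (ModuleCat.epi_iff_surjective _).2 hps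
      apply Ext.precomp_mk₀_injective_of_epi N (ModuleCat.ofHom p)
      rw [map_zero]
      exact hx
    | succ i =>
      obtain ⟨y, rfl⟩ := Ext.contravariant_sequence_exact₃
        (ses (LinearMap.ker p).subtype p Subtype.val_injective hps
          (LinearMap.exact_subtype_ker_map p)) _ x hx (add_comm 1 i)
      have := EZ_K2 a N (i+1) (fun j hj => ih j hj (by lia)) i (by lia) t (LinearMap.ker p)
        (fun r hr l => Subtype.ext (quot_kill a t r hr l)) y
      rw [this, Ext.comp_zero]

lemma V_finite (n : ℕ) (hn : ∀ (N : Type u)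
    [AddCommGroup N] [Module R N], ∀ i, n < i → V a i (ModuleCat.of R N)) (d : ℕ) :
    ∀ i, n < i + d → (∀ j ≥ i, V a j (ModuleCat.of R R)) → ∀ (L : Type u) [AddCommGroup L]
      [Module R L] [Module.Finite R L], V a i (ModuleCat.of R L) := by
  induction d with
  | zero =>
    intro i hi _ L _ _ _
    exact hn L i hi
  | succ d ih =>
    intro i hi hR L _ _ _
    obtain ⟨m, f, hf⟩ := Module.Finite.exists_fin' R L
    exact V_right a (ses (LinearMap.ker f).subtype f Subtype.val_injective hf
      (LinearMap.exact_subtype_ker_map f)) (V_fin a (hR i le_rfl) m)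
      (ih (i+1) (by lia) (fun j hj => hR j (by lia)) _)

lemma V_fin_mod (i : ℕ) (hR : ∀ j ≥ i, V a j (ModuleCat.of R R)) (L : Type u) [AddCommGroup L]
      [Module R L] [Module.Finite R L] : V a i (ModuleCat.of R L) := by
  obtain ⟨n, hn⟩ := V_bound a
  exact V_finite a n hn (n + 1) i (by lia) hR L

end gr

section fin
variable {R : Type u} [CommRing R]  (a : Ideal R) (M : Type u) [AddCommGroup M] [Module R M]

lemma le_grade_iff [IsNoetherianRing R] (n : ℕ) : (n : ℕ∞) ≤ relGrade a M ↔ ∀ i < n, V a i (ModuleCat.of R M) := by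
  rw [← EZ_V]
  simp only [relGrade, le_sInf_iff, Set.forall_mem_image, Set.mem_ofPred_eq, nontrivial_iff,
    Nat.cast_le]
  constructor
  · intro h i hi x
    by_contra hx
    exact absurd (h ⟨x, hx⟩) (by lia)
  · rintro h i ⟨x, hx⟩
    by_contra hi
    exact hx (h i (by lia) x)

lemma cohDim_le_iff (n : ℕ∞) : cohDim a M ≤ n ↔ ∀ i : ℕ, ¬ V a i (ModuleCat.of R M) → (i : ℕ∞) ≤ n := by
  simp only [cohDim, sSup_le_iff, Set.forall_mem_image, Set.mem_ofPred_eq, nontrivial_lc_iff]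

lemma V_tsze [Module Rᵐᵒᵖ M] [IsCentralScalar R M] (i : ℕ) :
    V a i (ModuleCat.of R (TrivSqZeroExt R M)) ↔ V a i (ModuleCat.of R R) ∧ V a i (ModuleCat.of R M) := by
  constructor
  · intro h
    constructor
    · refine V_retract a (ModuleCat.ofHom (TrivSqZeroExt.inlAlgHom R R M).toLinearMap)
        (ModuleCat.ofHom (TrivSqZeroExt.fstHom R R M).toLinearMap) ?_ h
      ext; simp
    · refine V_retract a (ModuleCat.ofHom (TrivSqZeroExt.inrHom R M))
        (ModuleCat.ofHom (TrivSqZeroExt.sndHom R M)) ?_ h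
      ext; simp
  · rintro ⟨h1, h2⟩
    refine V_mid a (ses (TrivSqZeroExt.inrHom R M) (TrivSqZeroExt.fstHom R R M).toLinearMap
      TrivSqZeroExt.inr_injective TrivSqZeroExt.fst_surjective ?_) h2 h1
    intro x
    constructor
    · intro h
      refine ⟨x.snd, ?_⟩
      ext
      · simpa using h.symm
      · simp
    · rintro ⟨m, rfl⟩
      simp
end fin
end Br

theorem stmt9 {R : Type u} [CommRing R] [IsNoetherianRing R]
    (a : Ideal R) (M : Type u) [AddCommGroup M] [Module R M] [Module Rᵐᵒᵖ M] [IsCentralScalar R M] [Module.Finite R M] :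
    relGrade (a.map (algebraMap R (TrivSqZeroExt R M))) (TrivSqZeroExt R M) =
        min (relGrade a R) (relGrade a M) ∧
      cohDim (a.map (algebraMap R (TrivSqZeroExt R M))) (TrivSqZeroExt R M) =
        cohDim a R := by
  have hfin : Module.Finite R (TrivSqZeroExt R M) := inferInstanceAs (Module.Finite R (R × M))
  have hN : IsNoetherianRing (TrivSqZeroExt R M) := IsNoetherianRing.of_finite R _
  have key : ∀ i, Br.V (a.map (algebraMap R (TrivSqZeroExt R M))) i
      (ModuleCat.of (TrivSqZeroExt R M) (TrivSqZeroExt R M)) ↔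
      Br.V a i (ModuleCat.of R R) ∧ Br.V a i (ModuleCat.of R M) := fun i =>
    (Br.indep a i (TrivSqZeroExt R M)).trans (Br.V_tsze a M i)
  constructor
  · apply le_antisymm
    · rw [← ENat.forall_natCast_le_iff_le]
      intro n hn
      rw [Br.le_grade_iff] at hn
      rw [le_min_iff, Br.le_grade_iff, Br.le_grade_iff]
      exact ⟨fun i hi => ((key i).1 (hn i hi)).1, fun i hi => ((key i).1 (hn i hi)).2⟩
    · rw [← ENat.forall_natCast_le_iff_le]
      intro n hn
      rw [le_min_iff, Br.le_grade_iff, Br.le_grade_iff] at hn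
      rw [Br.le_grade_iff]
      exact fun i hi => (key i).2 ⟨hn.1 i hi, hn.2 i hi⟩
  · apply le_antisymm
    · rw [Br.cohDim_le_iff]
      intro i hi
      rw [key] at hi
      by_contra hlt
      have hR : ∀ j ≥ i, Br.V a j (ModuleCat.of R R) := by
        intro j hj
        by_contra hV
        exact hlt (le_trans (by exact_mod_cast hj) ((Br.cohDim_le_iff a R _).1 le_rfl j hV))
      exact hi ⟨hR i le_rfl, Br.V_fin_mod a i hR M⟩
    · rw [Br.cohDim_le_iff]
      intro i hi
      exact (Br.cohDim_le_iff _ _ _).1 le_rfl i (fun h => hi ((key i).1 h).1)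

end
end

section
/- Let 𝔞 be an ideal of R, M a finitely generated R-module with M ≠ 𝔞M, and T = R ⋉ M. Then T is 𝔞T-relative Cohen-Macaulay if and only if R is 𝔞-relative Cohen-Macaulay and M is 𝔞-relative maximal Cohen-Macaulay. -/
open CategoryTheory TensorProduct

noncomputable section

universe u

section OldExt
open Limits Opposite

lemma op_gen1 {R : Type u} [CommRing R] (K : ChainComplex (ModuleCat.{u} R)ᵒᵖ ℕ) (n : ℕ)
    (z : (K.X n).unop) (hz : (K.d (n+1) n).unop z = 0) :
    ∃ w : (K.opcycles n).unop, (K.pOpcycles n).unop w = z := by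
  have h := ShortComplex.exact_of_g_is_cokernel
    (ShortComplex.mk (K.d (n+1) n) (K.pOpcycles n) (by simp))
    (K.opcyclesIsCokernel (n+1) n (by simp))
  have h2 := (ShortComplex.moduleCat_exact_iff _).1 h.unop
  exact h2 z hz

lemma op_gen2 {R : Type u} [CommRing R] (K : ChainComplex (ModuleCat.{u} R)ᵒᵖ ℕ) (n : ℕ)
    (z : (K.homology n).unop) :
    ∃ w : (K.opcycles n).unop, (K.homologyι n).unop w = z := by
  exact (ModuleCat.epi_iff_surjective (K.homologyι n).unop).1 inferInstance z

lemma op_gen3 {R : Type u} [CommRing R] (K : ChainComplex (ModuleCat.{u} R)ᵒᵖ ℕ) (n m : ℕ)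
    (hm : (ComplexShape.down ℕ).next n = m)
    (w : (K.opcycles n).unop) : (K.homologyι n).unop w = 0 ↔
    ∃ v : (K.X m).unop, (K.d n m).unop v = (K.pOpcycles n).unop w := by
  have h := ShortComplex.exact_of_f_is_kernel
    (ShortComplex.mk (K.homologyι n) (K.fromOpcycles n m) (by simp))
    (K.homologyIsKernel n m hm)
  have h2 := (ShortComplex.moduleCat_exact_iff _).1 h.unop
  have inj : Function.Injective (K.pOpcycles n).unop :=
    (ModuleCat.mono_iff_injective (K.pOpcycles n).unop).1 inferInstance
  have e : (K.d n m).unop = (K.fromOpcycles n m).unop ≫ (K.pOpcycles n).unop := by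
    rw [← unop_comp, HomologicalComplex.p_fromOpcycles]
  have e2 : (K.fromOpcycles n m).unop ≫ (K.homologyι n).unop = 0 := by
    rw [← unop_comp, HomologicalComplex.homologyι_comp_fromOpcycles]; rfl
  constructor
  · intro hw
    obtain ⟨v, hv⟩ := h2 w hw
    refine ⟨v, ?_⟩
    rw [e, ← hv]; rfl
  · rintro ⟨v, hv⟩
    rw [e] at hv
    have : (K.fromOpcycles n m).unop v = w := inj hv
    rw [← this]
    exact congrArg (fun q => q.hom v) e2

variable {R : Type u} [CommRing R]

/-- the complex computing the old Ext -/
abbrev oldK {X : ModuleCat.{u} R} (P : ProjectiveResolution X) (Y : ModuleCat.{u} R) :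
    ChainComplex (ModuleCat.{u} R)ᵒᵖ ℕ :=
  (((linearYoneda R (ModuleCat.{u} R)).obj Y).rightOp.mapHomologicalComplex _).obj P.complex

/-- the old Ext module -/
abbrev OE (n : ℕ) (X Y : ModuleCat.{u} R) : ModuleCat.{u} R :=
  ((Ext R (ModuleCat.{u} R) n).obj (op X)).obj Y

abbrev OEmap (n : ℕ) {X X' : ModuleCat.{u} R} (g : X' ⟶ X) (Y : ModuleCat.{u} R) :
    OE n X Y ⟶ OE n X' Y :=
  ((Ext R (ModuleCat.{u} R) n).map g.op).app Y

/-- iso from homology -/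
def oldIso {X : ModuleCat.{u} R} (P : ProjectiveResolution X) (Y : ModuleCat.{u} R) (n : ℕ) :
    ((oldK P Y).homology n).unop ≅ OE n X Y :=
  (P.isoLeftDerivedObj ((linearYoneda R (ModuleCat.{u} R)).obj Y).rightOp n).unop

lemma oldIso_nat {X X' : ModuleCat.{u} R} (P : ProjectiveResolution X)
    (P' : ProjectiveResolution X') (g : X' ⟶ X) (φ : P'.Hom P g) (Y : ModuleCat.{u} R) (n : ℕ) :
    (oldIso P Y n).hom ≫ OEmap n g Y =
      (HomologicalComplex.homologyMap
        ((((linearYoneda R (ModuleCat.{u} R)).obj Y).rightOp.mapHomologicalComplex _).map φ.hom)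
          n).unop ≫ (oldIso P' Y n).hom := by
  have := ProjectiveResolution.isoLeftDerivedObj_hom_naturality g P' P φ.hom
    φ.hom_f_zero_comp_π_f_zero ((linearYoneda R (ModuleCat.{u} R)).obj Y).rightOp n
  exact congrArg Quiver.Hom.unop this

/-- `f` represents the class `e`. -/
def OldRep {X : ModuleCat.{u} R} (P : ProjectiveResolution X) {Y : ModuleCat.{u} R} {n : ℕ}
    (f : P.complex.X n ⟶ Y) (e : OE n X Y) : Prop :=
  ∃ w : ((oldK P Y).opcycles n).unop, ((oldK P Y).pOpcycles n).unop w = f ∧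
    (oldIso P Y n).hom (((oldK P Y).homologyι n).unop w) = e

def Bdry {X : ModuleCat.{u} R} (P : ProjectiveResolution X) {Y : ModuleCat.{u} R} {n : ℕ}
    (f : P.complex.X n ⟶ Y) : Prop :=
  ∃ g : P.complex.X ((ComplexShape.down ℕ).next n) ⟶ Y,
    P.complex.d n ((ComplexShape.down ℕ).next n) ≫ g = f

variable {X : ModuleCat.{u} R} (P : ProjectiveResolution X) {Y : ModuleCat.{u} R} {n : ℕ}

lemma OldRep.ofCocycle (f : P.complex.X n ⟶ Y) (hf : P.complex.d (n+1) n ≫ f = 0) :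
    ∃ e : OE n X Y, OldRep P f e := by
  obtain ⟨w, hw⟩ := op_gen1 (oldK P Y) n f hf
  exact ⟨_, w, hw, rfl⟩

lemma OldRep.cocycle (e : OE n X Y) :
    ∃ f : P.complex.X n ⟶ Y, P.complex.d (n+1) n ≫ f = 0 ∧ OldRep P f e := by
  obtain ⟨w, hw⟩ := op_gen2 (oldK P Y) n ((oldIso P Y n).inv e)
  refine ⟨((oldK P Y).pOpcycles n).unop w, ?_, w, rfl, ?_⟩
  · have : ((oldK P Y).pOpcycles n).unop ≫ ((oldK P Y).d (n+1) n).unop = 0 := by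
      rw [← unop_comp, HomologicalComplex.d_pOpcycles]; rfl
    exact congrArg (fun q => q.hom w) this
  · rw [hw]
    exact congrArg (fun q => q.hom e) (oldIso P Y n).inv_hom_id

lemma OldRep.eq_zero_iff {f : P.complex.X n ⟶ Y} {e : OE n X Y} (h : OldRep P f e) :
    e = 0 ↔ Bdry P f := by
  obtain ⟨w, rfl, rfl⟩ := h
  have inj : Function.Injective (oldIso P Y n).hom :=
    (ModuleCat.mono_iff_injective _).1 inferInstance
  rw [map_eq_zero_iff _ inj]
  exact op_gen3 (oldK P Y) n _ rfl w

lemma OldRep.map {X' : ModuleCat.{u} R} (P' : ProjectiveResolution X') {g : X' ⟶ X}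
    (φ : P'.Hom P g) {f : P.complex.X n ⟶ Y} {e : OE n X Y} (h : OldRep P f e) :
    OldRep P' (φ.hom.f n ≫ f) (OEmap n g Y e) := by
  obtain ⟨w, rfl, rfl⟩ := h
  let ψ := ((((linearYoneda R (ModuleCat.{u} R)).obj Y).rightOp.mapHomologicalComplex
    (ComplexShape.down ℕ)).map φ.hom)
  refine ⟨(HomologicalComplex.opcyclesMap ψ n).unop w, ?_, ?_⟩
  · have := congrArg Quiver.Hom.unop (HomologicalComplex.p_opcyclesMap ψ n)
    exact congrArg (fun q => q.hom w) this
  · have h1 := congrArg Quiver.Hom.unop (HomologicalComplex.homologyι_naturality ψ n)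
    have h2 := oldIso_nat P P' g φ Y n
    have h3 := congrArg (fun q => q.hom (((oldK P Y).homologyι n).unop w)) h2
    have h4 := congrArg (fun q => (oldIso P' Y n).hom (q.hom w)) h1
    refine Eq.trans ?_ h3.symm
    exact h4.symm

section NewExt

lemma extMk_zero_iff (f : P.complex.X n ⟶ Y) (hf : P.complex.d (n+1) n ≫ f = 0) :
    P.extMk f (n+1) rfl hf = 0 ↔ Bdry P f := by
  rcases n with _ | p
  · constructor
    · intro h
      have h' := congrArg P.extEquivCohomologyClass h
      rw [ProjectiveResolution.extEquivCohomologyClass_extMk,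
        ProjectiveResolution.extEquivCohomologyClass_zero,
        CochainComplex.HomComplex.CohomologyClass.mk_eq_zero_iff,
        CochainComplex.HomComplex.Cocycle.toSingleMk_mem_coboundaries_iff _ _ _ _ _ 1
          (by simp)] at h'
      obtain ⟨g, hg⟩ := h'
      have hz : IsZero (P.cochainComplex.X 1) :=
        P.cochainComplex.isZero_of_isStrictlyLE 0 1 (by simp)
      rw [hz.eq_of_src g 0, comp_zero] at hg
      have hf0 : f = 0 := by
        rw [← cancel_epi (P.cochainComplexXIso (-(0:ℕ)) 0 rfl).hom, ← hg, comp_zero]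
      exact ⟨0, by rw [hf0, comp_zero]⟩
    · rintro ⟨g, hg⟩
      rw [HomologicalComplex.shape _ _ _ (by simp), zero_comp] at hg
      subst hg
      exact P.extMk_zero _ _
  · rw [P.extMk_eq_zero_iff f (p+1+1) rfl hf p rfl]
    unfold Bdry
    rw [ChainComplex.next_nat_succ]

lemma link_old_new (e : OE n X Y) : ∃ e' : Abelian.Ext X Y n, ∀ (X' : ModuleCat.{u} R) (g : X' ⟶ X),
    OEmap n g Y e = 0 ↔ (Abelian.Ext.mk₀ g).comp e' (zero_add n) = 0 := by
  let P := projectiveResolution X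
  obtain ⟨f, hf, hr⟩ := OldRep.cocycle P e
  refine ⟨P.extMk f _ rfl hf, fun X' g => ?_⟩
  let P' := projectiveResolution X'
  let φ : P'.Hom P g := ⟨ProjectiveResolution.lift g P' P, ProjectiveResolution.lift_commutes_zero g P' P⟩
  rw [(hr.map P P' φ).eq_zero_iff, ProjectiveResolution.mk₀_comp_extMk f _ rfl hf φ,
    extMk_zero_iff]

lemma link_new_old (e' : Abelian.Ext X Y n) : ∃ e : OE n X Y, ∀ (X' : ModuleCat.{u} R) (g : X' ⟶ X),
    OEmap n g Y e = 0 ↔ (Abelian.Ext.mk₀ g).comp e' (zero_add n) = 0 := by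
  let P := projectiveResolution X
  obtain ⟨f, hf, rfl⟩ := P.extMk_surjective e' _ rfl
  obtain ⟨e, hr⟩ := OldRep.ofCocycle P f hf
  refine ⟨e, fun X' g => ?_⟩
  let P' := projectiveResolution X'
  let φ : P'.Hom P g := ⟨ProjectiveResolution.lift g P' P, ProjectiveResolution.lift_commutes_zero g P' P⟩
  rw [(hr.map P P' φ).eq_zero_iff, ProjectiveResolution.mk₀_comp_extMk f _ rfl hf φ,
    extMk_zero_iff]

lemma nontrivial_link : Nontrivial (OE n X Y) ↔ ∃ e : Abelian.Ext X Y n, e ≠ 0 := by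
  have hid : ∀ e : OE n X Y, OEmap n (𝟙 X) Y e = e := fun e => by
    have : OEmap n (𝟙 X) Y = 𝟙 _ := by
      unfold OEmap
      rw [op_id, CategoryTheory.Functor.map_id, NatTrans.id_app]
    rw [this]; rfl
  rw [nontrivial_iff_exists_ne 0]
  constructor
  · rintro ⟨e, he⟩
    obtain ⟨e', h⟩ := link_old_new e
    have := h X (𝟙 X)
    rw [hid, Abelian.Ext.mk₀_id_comp] at this
    exact ⟨e', fun h => he (this.2 h)⟩
  · rintro ⟨e', he⟩
    obtain ⟨e, h⟩ := link_new_old e'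
    have := h X (𝟙 X)
    rw [hid, Abelian.Ext.mk₀_id_comp] at this
    exact ⟨e, fun h => he (this.1 h)⟩

/-- the map `R/I → R/J` given by multiplication by `c` -/
def qm (I J : Ideal R) (c : R) (h : ∀ y ∈ I, c * y ∈ J) :
    ModuleCat.of R (R ⧸ I) ⟶ ModuleCat.of R (R ⧸ J) :=
  ModuleCat.ofHom (Submodule.mapQ I J (LinearMap.lsmul R R c) h)

/-- the projection `R/I → R/J` -/
def qp (I J : Ideal R) (h : I ≤ J) : ModuleCat.of R (R ⧸ I) ⟶ ModuleCat.of R (R ⧸ J) :=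
  qm I J 1 (fun y hy => by simpa using h hy)

/-- vanishing of local cohomology, in terms of the new Ext -/
def LC (a : Ideal R) (i : ℕ) (N : ModuleCat.{u} R) : Prop :=
  ∀ t : ℕ, ∀ e : Abelian.Ext (ModuleCat.of R (R ⧸ a ^ t)) N i, ∃ s, ∃ h : t ≤ s,
    (Abelian.Ext.mk₀ (qp (a ^ s) (a ^ t) (Ideal.pow_le_pow_right h))).comp e (zero_add i) = 0

lemma qp_eq (I J : Ideal R) (h : I ≤ J) :
    qp I J h = ModuleCat.ofHom (Submodule.mapQ I J LinearMap.id h) := by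
  unfold qp qm
  congr 1
  apply LinearMap.ext
  intro x
  obtain ⟨x, rfl⟩ := Submodule.mkQ_surjective _ x
  change Submodule.Quotient.mk (1 * x) = Submodule.Quotient.mk x
  rw [one_mul]

lemma lc_link (a : Ideal R) (i : ℕ) (N : ModuleCat.{u} R) :
    Nontrivial ((localCohomology a i).obj N) ↔ ¬ LC a i N := by
  let F := localCohomology.diagram (localCohomology.idealPowersDiagram a) i
  let G : (ℕᵒᵖ)ᵒᵖ ⥤ ModuleCat.{u} R := F ⋙ (evaluation _ _).obj N
  have iso : (localCohomology a i).obj N ≅ colimit G := by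
    have := localCohomology.hasColimitDiagram.{u, 0} (localCohomology.idealPowersDiagram a) i
    exact colimitObjIsoColimitCompEvaluation F N
  have : PreservesFilteredColimitsOfSize.{0, 0} (forget (ModuleCat.{u} R)) :=
    preservesFilteredColimitsOfSize_shrink.{0, u, 0, u} _
  have hmap : ∀ (s t : ℕ) (h : t ≤ s), G.map (homOfLE h).op.op =
      OEmap i (qp (a ^ s) (a ^ t) (Ideal.pow_le_pow_right h)) N := by
    intro s t h
    rw [qp_eq]; rfl
  have key : ∀ (t : ℕ) (e : G.obj (op (op t))), colimit.ι G (op (op t)) e = 0 ↔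
      ∃ s, ∃ h : t ≤ s, OEmap i (qp (a ^ s) (a ^ t) (Ideal.pow_le_pow_right h)) N e = 0 := by
    intro t e
    constructor
    · intro h
      obtain ⟨k, f, hf⟩ := Concrete.colimit_rep_eq_zero R G (op (op t)) e h
      refine ⟨k.unop.unop, leOfHom f.unop.unop, ?_⟩
      rw [← hmap]; exact hf
    · rintro ⟨s, h, hs⟩
      rw [← hmap s t h] at hs
      have := congrArg (fun q => q.hom e) (colimit.w G (homOfLE h).op.op)
      refine this.symm.trans ?_
      change colimit.ι G _ (G.map _ e) = 0
      exact (congrArg _ hs).trans (map_zero _)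
  have h1 : Nontrivial ((localCohomology a i).obj N) ↔ Nontrivial (colimit G : ModuleCat.{u} R) :=
    iso.toLinearEquiv.toEquiv.nontrivial_congr
  rw [h1, nontrivial_iff_exists_ne 0]
  unfold LC
  push Not
  constructor
  · rintro ⟨x, hx⟩
    obtain ⟨j, y, rfl⟩ := Concrete.colimit_exists_rep G x
    obtain ⟨e', he⟩ := link_old_new (n := i) (Y := N) (X := ModuleCat.of R (R ⧸ a ^ j.unop.unop)) y
    refine ⟨j.unop.unop, e', fun s h => ?_⟩
    rw [ne_eq, ← he]
    intro h0
    exact hx ((key j.unop.unop y).2 ⟨s, h, h0⟩)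
  · rintro ⟨t, e', he'⟩
    obtain ⟨e, he⟩ := link_new_old e'
    refine ⟨colimit.ι G (op (op t)) e, fun h => ?_⟩
    obtain ⟨s, hs, h0⟩ := (key t e).1 h
    exact he' s hs ((he _ _).1 h0)

end NewExt

end OldExt

section PartB
open Limits Opposite
variable {R : Type u} [CommRing R]

/-- pullback of Ext classes -/
def pl {X X' N : ModuleCat.{u} R} {i : ℕ} (g : X' ⟶ X) (e : Abelian.Ext X N i) :
    Abelian.Ext X' N i := (Abelian.Ext.mk₀ g).comp e (zero_add i)

/-- pushforward of Ext classes -/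
def pu {X N N' : ModuleCat.{u} R} {i : ℕ} (e : Abelian.Ext X N i) (g : N ⟶ N') :
    Abelian.Ext X N' i := e.comp (Abelian.Ext.mk₀ g) (add_zero i)

lemma pl_pl {X X' X'' N : ModuleCat.{u} R} {i : ℕ} (h : X'' ⟶ X') (g : X' ⟶ X)
    (e : Abelian.Ext X N i) : pl h (pl g e) = pl (h ≫ g) e := by
  simp [pl]

lemma pl_zero {X X' N : ModuleCat.{u} R} {i : ℕ} (g : X' ⟶ X) :
    pl g (0 : Abelian.Ext X N i) = 0 := by
  simp [pl]

lemma pl_add {X X' N : ModuleCat.{u} R} {i : ℕ} (g : X' ⟶ X) (e e' : Abelian.Ext X N i) :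
    pl g (e + e') = pl g e + pl g e' := by
  simp [pl]

lemma pu_zero {X N N' : ModuleCat.{u} R} {i : ℕ} (g : N ⟶ N') :
    pu (0 : Abelian.Ext X N i) g = 0 := by
  simp [pu]

lemma pl_pu {X X' N N' : ModuleCat.{u} R} {i : ℕ} (h : X' ⟶ X) (g : N ⟶ N')
    (e : Abelian.Ext X N i) : pl h (pu e g) = pu (pl h e) g := by
  simp only [pl, pu]
  rw [Abelian.Ext.comp_assoc _ _ _ (zero_add i) (add_zero i) (by omega)]

lemma pu_pu {X N N' N'' : ModuleCat.{u} R} {i : ℕ} (g : N ⟶ N') (g' : N' ⟶ N'')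
    (e : Abelian.Ext X N i) : pu (pu e g) g' = pu e (g ≫ g') := by
  simp only [pu]
  rw [Abelian.Ext.comp_assoc_of_third_deg_zero, Abelian.Ext.mk₀_comp_mk₀]

lemma pu_id {X N : ModuleCat.{u} R} {i : ℕ} (e : Abelian.Ext X N i) : pu e (𝟙 N) = e := by
  simp [pu]

lemma pl_mk₀ {X X' N : ModuleCat.{u} R} (g : X' ⟶ X) (f : X ⟶ N) :
    pl g (Abelian.Ext.mk₀ f) = Abelian.Ext.mk₀ (g ≫ f) := by
  simp [pl]

lemma pu_mk₀ {X N N' : ModuleCat.{u} R} (g : N ⟶ N') (f : X ⟶ N) :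
    pu (Abelian.Ext.mk₀ f) g = Abelian.Ext.mk₀ (f ≫ g) := by
  simp [pu]

lemma ses_of {A B C : Type u} [AddCommGroup A] [AddCommGroup B] [AddCommGroup C] [Module R A]
    [Module R B] [Module R C] (f : A →ₗ[R] B) (g : B →ₗ[R] C) (hf : Function.Injective f)
    (hg : Function.Surjective g) (h : Function.Exact f g) (w : ModuleCat.ofHom f ≫ ModuleCat.ofHom g = 0) :
    (ShortComplex.mk (ModuleCat.ofHom f) (ModuleCat.ofHom g) w).ShortExact := by
  have := (ModuleCat.mono_iff_injective (ModuleCat.ofHom f)).2 hf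
  have := (ModuleCat.epi_iff_surjective (ModuleCat.ofHom g)).2 hg
  refine ⟨?_⟩
  rw [ShortComplex.moduleCat_exact_iff]
  intro x hx
  exact (h x).1 hx

lemma ses_w {A B C : Type u} [AddCommGroup A] [AddCommGroup B] [AddCommGroup C] [Module R A]
    [Module R B] [Module R C] (f : A →ₗ[R] B) (g : B →ₗ[R] C)
    (h : Function.Exact f g) : ModuleCat.ofHom f ≫ ModuleCat.ofHom g = 0 := by
  rw [← ModuleCat.ofHom_comp, h.linearMap_comp_eq_zero]; rfl

lemma qm_comp (I J K : Ideal R) (c d : R) (h : ∀ y ∈ I, c * y ∈ J) (h' : ∀ y ∈ J, d * y ∈ K)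
    (h'' : ∀ y ∈ I, (c * d) * y ∈ K) :
    qm I J c h ≫ qm J K d h' = qm I K (c * d) h'' := by
  unfold qm
  rw [← ModuleCat.ofHom_comp]
  congr 1
  apply LinearMap.ext
  intro x
  obtain ⟨x, rfl⟩ := Submodule.mkQ_surjective _ x
  change Submodule.Quotient.mk (d * (c * x)) = Submodule.Quotient.mk (c * d * x)
  congr 1; ring

lemma qm_congr (I J : Ideal R) (c d : R) (h : ∀ y ∈ I, c * y ∈ J) (e : c = d) :
    qm I J c h = qm I J d (by subst e; exact h) := by subst e; rfl

/-- the colon ideal -/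
def col (J : Ideal R) (y : R) : Ideal R := Submodule.comap (LinearMap.lsmul R R y) J

lemma mem_col (J : Ideal R) (y z : R) : z ∈ col J y ↔ y * z ∈ J := Iff.rfl

/-- `0 → R/(J:y) → R/J → R/(J+y) → 0` -/
def colS (J : Ideal R) (y : R) : ShortComplex (ModuleCat.{u} R) :=
  ShortComplex.mk (qm (col J y) J y (fun z hz => (mem_col J y z).1 hz)) (qp J (J ⊔ Ideal.span {y}) le_sup_left) (by
    unfold qp qm
    rw [← ModuleCat.ofHom_comp]
    suffices h : (Submodule.mapQ J (J ⊔ Ideal.span {y}) (LinearMap.lsmul R R 1)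
      (fun z hz => by simpa using Ideal.mem_sup_left hz)) ∘ₗ
        (Submodule.mapQ (col J y) J (LinearMap.lsmul R R y) (fun _ h => h)) = 0 by rw [h]; rfl
    apply LinearMap.ext
    intro x
    obtain ⟨x, rfl⟩ := Submodule.mkQ_surjective _ x
    change Submodule.Quotient.mk (1 * (y * x)) = 0
    rw [Submodule.Quotient.mk_eq_zero, one_mul]
    exact Ideal.mem_sup_right (Ideal.mul_mem_right _ _ (Ideal.mem_span_singleton_self y)))

lemma colS_exact (J : Ideal R) (y : R) : (colS J y).ShortExact := by
  refine ses_of _ _ ?_ ?_ ?_ _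
  · rw [← LinearMap.ker_eq_bot, LinearMap.ker_eq_bot']
    intro x
    obtain ⟨x, rfl⟩ := Submodule.mkQ_surjective _ x
    intro hx
    change Submodule.Quotient.mk (y * x) = 0 at hx
    rw [Submodule.Quotient.mk_eq_zero] at hx
    exact (Submodule.Quotient.mk_eq_zero _).2 hx
  · intro x
    obtain ⟨x, rfl⟩ := Submodule.mkQ_surjective _ x
    refine ⟨Submodule.Quotient.mk x, ?_⟩
    change Submodule.Quotient.mk (1 * x) = Submodule.Quotient.mk x
    rw [one_mul]
  · intro x
    obtain ⟨x, rfl⟩ := Submodule.mkQ_surjective _ x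
    constructor
    · intro hx
      change Submodule.Quotient.mk (1 * x) = 0 at hx
      rw [one_mul, Submodule.Quotient.mk_eq_zero] at hx
      obtain ⟨j, hj, z, hz, rfl⟩ := Submodule.mem_sup.1 hx
      obtain ⟨c, rfl⟩ := Ideal.mem_span_singleton'.1 hz
      refine ⟨Submodule.Quotient.mk c, ?_⟩
      change Submodule.Quotient.mk (y * c) = Submodule.Quotient.mk (j + c * y)
      rw [Submodule.Quotient.eq]
      have : y * c - (j + c * y) = -j := by ring
      rw [this]; exact neg_mem hj
    · rintro ⟨z, hz⟩
      obtain ⟨z, rfl⟩ := Submodule.mkQ_surjective _ z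
      rw [← hz]
      change Submodule.Quotient.mk (1 * (y * z)) = 0
      rw [Submodule.Quotient.mk_eq_zero, one_mul]
      exact Ideal.mem_sup_right (Ideal.mul_mem_right _ _ (Ideal.mem_span_singleton_self y))


lemma col_le (J J' : Ideal R) (h : J ≤ J') (y y' c : R) (hc : y = c * y') :
    ∀ z ∈ col J y, c * z ∈ col J' y' := fun z hz => by
  rw [mem_col] at hz ⊢
  have := h hz
  rwa [hc, mul_comm c, mul_assoc] at this

lemma sup_span_le (J J' : Ideal R) (h : J ≤ J') (y y' c : R) (hc : y = c * y') :
    J ⊔ Ideal.span {y} ≤ J' ⊔ Ideal.span {y'} := (sup_le (h.trans le_sup_left) (by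
    rw [Ideal.span_singleton_le_iff_mem, hc]
    exact Ideal.mem_sup_right (Ideal.mul_mem_left _ _ (Ideal.mem_span_singleton_self y'))))

/-- morphism of colon sequences -/
def colSMap (J J' : Ideal R) (h : J ≤ J') (y y' c : R) (hc : y = c * y') : colS J y ⟶ colS J' y' where
  τ₁ := qm (col J y) (col J' y') c (col_le J J' h y y' c hc)
  τ₂ := qp J J' h
  τ₃ := qp _ _ (sup_span_le J J' h y y' c hc)
  comm₁₂ := by
    subst hc
    refine (qm_comp _ _ _ _ _ _ _ (fun z hz => by rw [mem_col] at hz; exact h hz)).trans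
      (Eq.trans ?_ (qm_comp _ _ _ _ _ _ _ (fun z hz => by rw [mem_col] at hz; simpa using h hz)).symm)
    exact qm_congr _ _ _ _ _ (by ring)
  comm₂₃ := by
    refine (qm_comp _ _ _ _ _ _ _ (fun z hz => by simpa using Ideal.mem_sup_left (h hz))).trans
      (qm_comp _ _ _ _ _ _ _ (fun z hz => by simpa using Ideal.mem_sup_left (h hz))).symm

lemma qp_comp (I J K : Ideal R) (h : I ≤ J) (h' : J ≤ K) : qp I J h ≫ qp J K h' = qp I K (h.trans h') := by
  refine (qm_comp _ _ _ _ _ _ _ (fun z hz => by simpa using h' (h hz))).trans ?_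
  exact qm_congr _ _ _ _ _ (by ring)

/-- ind-vanishing of `Ext^i(R/J_t, N)` -/
def IZ (J : ℕ → Ideal R) (i : ℕ) (N : ModuleCat.{u} R) : Prop :=
  ∀ t : ℕ, ∀ e : Abelian.Ext (ModuleCat.of R (R ⧸ J t)) N i, ∃ s, ∃ _ : t ≤ s, ∃ h : J s ≤ J t,
    pl (qp (J s) (J t) h) e = 0

/-- connecting map of the colon sequence -/
def dl (J : Ideal R) (y : R) {N : ModuleCat.{u} R} {i : ℕ}
    (e : Abelian.Ext (ModuleCat.of R (R ⧸ col J y)) N i) :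
    Abelian.Ext (ModuleCat.of R (R ⧸ (J ⊔ Ideal.span {y}))) N (1 + i) :=
  (colS_exact J y).extClass.comp (Y := ModuleCat.of R (R ⧸ col J y)) e rfl

lemma dl_zero (J : Ideal R) (y : R) {N : ModuleCat.{u} R} {i : ℕ} :
    dl J y (0 : Abelian.Ext (ModuleCat.of R (R ⧸ col J y)) N i) = 0 :=
  Abelian.Ext.comp_zero _ _ _ _ _

lemma dl_ext (J : Ideal R) (y : R) {N : ModuleCat.{u} R} {i : ℕ}
    (e : Abelian.Ext (ModuleCat.of R (R ⧸ J)) N i) :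
    dl J y (pl (qm (col J y) J y (fun z hz => (mem_col J y z).1 hz)) e) = 0 := by
  exact (colS_exact J y).extClass_comp_assoc e

lemma dl_exact (J : Ideal R) (y : R) {N : ModuleCat.{u} R} {i : ℕ}
    (e : Abelian.Ext (ModuleCat.of R (R ⧸ (J ⊔ Ideal.span {y}))) N (1 + i))
    (h : pl (qp J (J ⊔ Ideal.span {y}) le_sup_left) e = 0) :
    ∃ e2 : Abelian.Ext (ModuleCat.of R (R ⧸ col J y)) N i, dl J y e2 = e :=
  Abelian.Ext.contravariant_sequence_exact₃ (colS_exact J y) _ e h (n₀ := i) rfl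

lemma dl_nat (J J' : Ideal R) (h : J ≤ J') (y y' c : R) (hc : y = c * y') {N : ModuleCat.{u} R}
    {i : ℕ} (e : Abelian.Ext (ModuleCat.of R (R ⧸ col J' y')) N i) :
    pl (qp _ _ (sup_span_le J J' h y y' c hc)) (dl J' y' e)
      = dl J y (pl (qm (col J y) (col J' y') c (col_le J J' h y y' c hc)) e) := by
  have := ShortComplex.ShortExact.extClass_naturality (colS_exact J y) (colS_exact J' y')
    (colSMap J J' h y y' c hc)
  simp only [pl, dl]
  refine (Abelian.Ext.comp_assoc _ _ _ (zero_add 1) rfl (by omega)).symm.trans ?_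
  refine Eq.trans ?_ (Abelian.Ext.comp_assoc _ _ _ (add_zero 1) (zero_add i) (by omega))
  exact congrArg (fun q => Abelian.Ext.comp q e rfl) this.symm

lemma pow_split (x : R) {s t : ℕ} (h : t ≤ s) : x ^ s = x ^ (s - t) * x ^ t := by
  rw [← pow_add, Nat.sub_add_cancel h]

lemma step_lemma (J : ℕ → Ideal R) (x : R) (i : ℕ) (N : ModuleCat.{u} R) (h1 : IZ J (1 + i) N)
    (h2 : ∀ t (e : Abelian.Ext (ModuleCat.of R (R ⧸ col (J t) (x ^ t))) N i),
      ∃ s, ∃ hs : t ≤ s, ∃ h : J s ≤ J t, dl (J s) (x ^ s)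
        (pl (qm _ _ (x ^ (s - t)) (col_le (J s) (J t) h (x ^ s) (x ^ t) (x ^ (s - t))
          (pow_split x hs))) e) = 0) :
    IZ (fun t => J t ⊔ Ideal.span {x ^ t}) (1 + i) N := by
  intro t e
  change Abelian.Ext (ModuleCat.of R (R ⧸ (J t ⊔ Ideal.span {x ^ t}))) N (1 + i) at e
  obtain ⟨s, hts, hJ, hs⟩ := h1 t (pl (qp (J t) _ le_sup_left) e)
  have hle := sup_span_le _ _ hJ _ _ _ (pow_split x hts)
  obtain ⟨e2, he2⟩ := dl_exact (J s) (x ^ s) (pl (qp _ _ hle) e) (by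
    rw [pl_pl, qp_comp] at hs ⊢
    exact hs)
  obtain ⟨r, hsr, hJr, hr⟩ := h2 s e2
  have := dl_nat (J r) (J s) hJr (x ^ r) (x ^ s) (x ^ (r - s)) (pow_split x hsr) e2
  rw [hr, he2, pl_pl, qp_comp] at this
  exact ⟨r, hts.trans hsr, _, this⟩

end PartB

section PartC
open Limits Opposite
variable {R : Type u} [CommRing R]

lemma exists_col_stable [IsNoetherianRing R] (J : Ideal R) (x : R) :
    ∃ m : ℕ, ∀ n z, x ^ n * z ∈ J → x ^ m * z ∈ J := by
  have hmono : Monotone (fun n => col J (x ^ n)) := by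
    intro n m h z hz
    rw [mem_col] at hz ⊢
    rw [pow_split x h, mul_assoc]
    exact Ideal.mul_mem_left _ _ hz
  obtain ⟨m, hm⟩ := monotone_stabilizes_iff_noetherian.2 (inferInstanceAs (IsNoetherian R R))
    ⟨_, hmono⟩
  refine ⟨m, fun n z hz => ?_⟩
  rcases le_total n m with h | h
  · exact hmono h hz
  · have := hm n h
    have h2 : z ∈ col J (x ^ n) := hz
    rw [show col J (x ^ n) = col J (x ^ m) from this.symm] at h2
    exact h2

lemma le_col (J : Ideal R) (y : R) : J ≤ col J y := fun z hz => by
  rw [mem_col]; exact Ideal.mul_mem_left _ _ hz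

lemma h2_of_IZ [IsNoetherianRing R] (J : ℕ → Ideal R) (hJ : Antitone J) (x : R) (i : ℕ)
    (N : ModuleCat.{u} R) (h : IZ J i N) (t : ℕ)
    (e : Abelian.Ext (ModuleCat.of R (R ⧸ col (J t) (x ^ t))) N i) :
      ∃ s, ∃ hs : t ≤ s, ∃ h : J s ≤ J t, dl (J s) (x ^ s)
        (pl (qm _ _ (x ^ (s - t)) (col_le (J s) (J t) h (x ^ s) (x ^ t) (x ^ (s - t))
          (pow_split x hs))) e) = 0 := by
  obtain ⟨r, htr, hr, h0⟩ := h t (pl (qp _ _ (le_col (J t) (x ^ t))) e)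
  obtain ⟨m, hm⟩ := exists_col_stable (J r) x
  have hrs : r ≤ r + m := Nat.le_add_right _ _
  refine ⟨r + m, htr.trans hrs, hJ (htr.trans hrs), ?_⟩
  rw [pl_pl, qp_comp] at h0
  have key : ∀ z ∈ col (J (r + m)) (x ^ (r + m)), x ^ (r + m - t) * z ∈ J r := by
    intro z hz
    have := hm _ _ (hJ hrs ((mem_col _ _ _).1 hz))
    have e : r + m - t = (r - t) + m := by omega
    rw [e, pow_add, mul_assoc]
    exact Ideal.mul_mem_left _ _ this
  have : qm _ _ (x ^ (r + m - t)) (col_le (J (r + m)) (J t) (hJ (htr.trans hrs)) (x ^ (r + m)) (x ^ t) (x ^ (r + m - t))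
          (pow_split x (htr.trans hrs))) =
      qm _ (J r) _ key ≫ qp (J r) (col (J t) (x ^ t)) (hr.trans (le_col _ _)) := by
    refine Eq.trans ?_ (qm_comp _ _ _ _ _ _ _ (fun z hz => by
      rw [mul_one]; exact (hr.trans (le_col _ _)) (key z hz))).symm
    exact qm_congr _ _ _ _ _ (by ring)
  rw [this, ← pl_pl, h0, pl_zero, dl_zero]

/-- powers of generators -/
def Jp : List R → ℕ → Ideal R
  | [], _ => ⊥
  | x :: xs, t => Jp xs t ⊔ Ideal.span {x ^ t}

lemma Jp_antitone (xs : List R) : Antitone (Jp xs) := by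
  induction xs with
  | nil => intro s t h; exact le_rfl
  | cons x xs ih => intro s t h; exact sup_span_le _ _ (ih h) _ _ _ (pow_split x h)

lemma IZ_nil (i : ℕ) (hi : 0 < i) (N : ModuleCat.{u} R) : IZ (Jp ([] : List R)) i N := by
  intro t e
  refine ⟨t, le_rfl, le_rfl, ?_⟩
  have : Module.Projective R (R ⧸ (Jp ([] : List R) t)) :=
    Module.Projective.of_equiv (Submodule.quotEquivOfEqBot (⊥ : Ideal R) rfl).symm
  have : Projective (ModuleCat.of R (R ⧸ (Jp ([] : List R) t))) :=
    (IsProjective.iff_projective _ ).1 this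
  obtain ⟨j, rfl⟩ := Nat.exists_eq_add_of_lt hi
  have e0 : e = 0 := by
    have : 0 + j + 1 = j + 1 := by omega
    revert e
    rw [this]
    intro e
    exact Abelian.Ext.eq_zero_of_projective e
  rw [e0, pl_zero]

lemma IZ_Jp [IsNoetherianRing R] (xs : List R) : ∀ i, xs.length < i → ∀ N : ModuleCat.{u} R,
    IZ (Jp xs) i N := by
  induction xs with
  | nil => intro i hi N; exact IZ_nil i hi N
  | cons x xs ih =>
    intro i hi N
    obtain ⟨j, rfl⟩ : ∃ j, i = 1 + j := ⟨i - 1, by omega⟩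
    simp only [List.length_cons] at hi
    exact step_lemma (Jp xs) x j N (ih _ (by omega) N)
      (h2_of_IZ _ (Jp_antitone xs) x j N (ih _ (by omega) N))

lemma pow_le_Jp (xs : List R) (t : ℕ) :
    ∃ m, Ideal.span {x | x ∈ xs} ^ m ≤ Jp xs t := by
  apply Ideal.exists_pow_le_of_le_radical_of_fg
  · rw [Ideal.span_le]
    induction xs with
    | nil => simp
    | cons x xs ih =>
      intro y hy
      rcases List.mem_cons.1 hy with rfl | h
      · exact ⟨t, Ideal.mem_sup_right (Ideal.mem_span_singleton_self _)⟩
      · exact Ideal.radical_mono le_sup_left (ih h)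
  · classical
    exact ⟨xs.toFinset, by congr 1; ext; simp⟩

lemma Jp_le_pow (xs : List R) (t : ℕ) (a : Ideal R) (h : ∀ x ∈ xs, x ∈ a) : Jp xs t ≤ a ^ t := by
  induction xs with
  | nil => exact bot_le
  | cons x xs ih =>
    refine sup_le (ih fun y hy => h y (List.mem_cons_of_mem _ hy)) ?_
    rw [Ideal.span_singleton_le_iff_mem]
    exact Ideal.pow_mem_pow (h x List.mem_cons_self) t

lemma LC_of_IZ (xs : List R) (i : ℕ) (N : ModuleCat.{u} R) (h : IZ (Jp xs) i N) :
    LC (Ideal.span {x | x ∈ xs}) i N := by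
  intro t e
  obtain ⟨s, hs, hJ, h0⟩ := h t (pl (qp _ _ (Jp_le_pow xs t _ (fun x hx => Ideal.subset_span hx))) e)
  obtain ⟨m, hm⟩ := pow_le_Jp xs s
  refine ⟨max m t, le_max_right _ _, ?_⟩
  change pl _ _ = 0
  rw [pl_pl, qp_comp] at h0
  have := congrArg (pl (qp _ _ ((Ideal.pow_le_pow_right (le_max_left m t)).trans hm))) h0
  rw [pl_pl, qp_comp, pl_zero] at this
  exact this

end PartC

section PartD
open Limits Opposite
variable {R : Type u} [CommRing R]

lemma inj_solve {T : Type u} [CommRing T] (I : Type u) [AddCommGroup I] [Module T I]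
    [Module.Injective T I] (J : Ideal T) (x : T) (y : I) (hy : ∀ u ∈ col J x, u • y = 0) :
    ∃ z : I, (∀ u ∈ J, u • z = 0) ∧ x • z = y := by
  let f : (T ⧸ col J x) →ₗ[T] (T ⧸ J) :=
    Submodule.mapQ (col J x) J (LinearMap.lsmul T T x) (fun z hz => hz)
  let g : (T ⧸ col J x) →ₗ[T] I := Submodule.liftQ (col J x) (LinearMap.toSpanSingleton T I y)
    (fun u hu => by simpa using hy u hu)
  have hf : Function.Injective f := by
    rw [← LinearMap.ker_eq_bot, LinearMap.ker_eq_bot']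
    intro x
    obtain ⟨x, rfl⟩ := Submodule.mkQ_surjective _ x
    intro hx
    change Submodule.Quotient.mk _ = 0 at hx
    rw [Submodule.Quotient.mk_eq_zero] at hx
    exact (Submodule.Quotient.mk_eq_zero _).2 hx
  obtain ⟨h, hh⟩ := Module.Injective.out f hf g
  refine ⟨h (Submodule.Quotient.mk 1), ?_, ?_⟩
  · intro u hu
    rw [← map_smul, ← Submodule.Quotient.mk_smul, smul_eq_mul, mul_one,
      (Submodule.Quotient.mk_eq_zero _).2 hu, map_zero]
  · have := hh (Submodule.Quotient.mk 1)
    have e1 : f (Submodule.Quotient.mk 1) = x • Submodule.Quotient.mk 1 := rfl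
    have e2 : g (Submodule.Quotient.mk 1) = y := one_smul _ _
    rw [e1, e2, map_smul] at this
    exact this

/-- the map `R/J → N` given by an element killed by `J` -/
def ez (J : Ideal R) {N : Type u} [AddCommGroup N] [Module R N] (z : N) (hz : ∀ u ∈ J, u • z = 0) :
    ModuleCat.of R (R ⧸ J) ⟶ ModuleCat.of R N :=
  ModuleCat.ofHom (Submodule.liftQ J (LinearMap.toSpanSingleton R N z)
    (fun u hu => by simpa using hz u hu))

lemma ez_congr (J : Ideal R) {N : Type u} [AddCommGroup N] [Module R N] (z z' : N)
    (hz : ∀ u ∈ J, u • z = 0) (hz' : ∀ u ∈ J, u • z' = 0) (h : z = z') :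
    ez J z hz = ez J z' hz' := by subst h; rfl

lemma ez_surj (J : Ideal R) {N : Type u} [AddCommGroup N] [Module R N]
    (f : ModuleCat.of R (R ⧸ J) ⟶ ModuleCat.of R N) : ∃ z hz, f = ez J (N := N) z hz := by
  refine ⟨f.hom (Submodule.Quotient.mk 1), ?_, ?_⟩
  · intro u hu
    rw [← map_smul, ← Submodule.Quotient.mk_smul, smul_eq_mul, mul_one,
      (Submodule.Quotient.mk_eq_zero _).2 hu, map_zero]
  · apply ModuleCat.hom_ext
    apply LinearMap.ext
    intro x
    obtain ⟨x, rfl⟩ := Submodule.mkQ_surjective _ x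
    change f.hom (Submodule.Quotient.mk x) = x • f.hom (Submodule.Quotient.mk 1)
    rw [← map_smul, ← Submodule.Quotient.mk_smul, smul_eq_mul, mul_one]

lemma qm_ez (J K : Ideal R) (c : R) (h : ∀ y ∈ J, c * y ∈ K) {N : Type u} [AddCommGroup N]
    [Module R N] (z : N) (hz : ∀ u ∈ K, u • z = 0) :
    qm J K c h ≫ ez K z hz = ez J (c • z) (fun u hu => by
      rw [← mul_smul, mul_comm]; exact hz _ (h _ hu)) := by
  apply ModuleCat.hom_ext
  apply LinearMap.ext
  intro x
  obtain ⟨x, rfl⟩ := Submodule.mkQ_surjective _ x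
  change (c * x) • z = x • c • z
  rw [← mul_smul, mul_comm]

lemma ext0 {X N : ModuleCat.{u} R} (e : Abelian.Ext X N 0) : ∃ f : X ⟶ N, e = Abelian.Ext.mk₀ f := by
  obtain ⟨f, hf⟩ := (Abelian.Ext.mk₀_bijective X N).2 e
  exact ⟨f, hf.symm⟩

lemma IZ_inj (T : Type u) [CommRing T] [IsNoetherianRing R] [IsNoetherianRing T] [Algebra R T]
    (I : Type u) [AddCommGroup I] [Module R I] [Module T I] [IsScalarTower R T I]
    [Module.Injective T I] (xs : List R) : ∀ i, 0 < i → IZ (Jp xs) i (ModuleCat.of R I) := by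
  induction xs with
  | nil => intro i hi; exact IZ_nil i hi _
  | cons x xs ih =>
    intro i hi
    obtain ⟨j, rfl⟩ : ∃ j, i = 1 + j := ⟨i - 1, by omega⟩
    refine step_lemma (Jp xs) x j _ (ih _ (by omega)) ?_
    rcases Nat.eq_zero_or_pos j with rfl | hj
    swap
    · exact h2_of_IZ _ (Jp_antitone xs) x j _ (ih _ hj)
    intro t e
    obtain ⟨f, rfl⟩ := ext0 e
    obtain ⟨y, hy, rfl⟩ := ez_surj _ f
    obtain ⟨m, hm⟩ := exists_col_stable ((Jp xs t).map (algebraMap R T)) (algebraMap R T x)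
    have hts : t ≤ t + m := Nat.le_add_right _ _
    have hJ := Jp_antitone xs hts
    refine ⟨t + m, hts, hJ, ?_⟩
    have hJy : ∀ u ∈ (Jp xs t).map (algebraMap R T), u • y = 0 := by
      intro u hu
      induction hu using Submodule.span_induction with
      | mem u hu =>
        obtain ⟨v, hv, rfl⟩ := hu
        rw [algebraMap_smul]
        exact hy v (le_col _ _ hv)
      | zero => simp
      | add a b _ _ ha hb => rw [add_smul, ha, hb, add_zero]
      | smul c b _ hb => rw [smul_assoc, hb, smul_zero]
    obtain ⟨z, hz, hxz⟩ := inj_solve I ((Jp xs (t + m)).map (algebraMap R T))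
      ((algebraMap R T x) ^ (t + m)) ((algebraMap R T x) ^ m • y) (by
        intro u hu
        rw [mem_col] at hu
        have := hm _ _ (Ideal.map_mono hJ hu)
        rw [← mul_smul, mul_comm]
        exact hJy _ this)
    have hz' : ∀ u ∈ Jp xs (t + m), u • z = 0 := fun u hu => by
      rw [← algebraMap_smul T]; exact hz _ (Ideal.mem_map_of_mem _ hu)
    have := dl_ext (Jp xs (t + m)) (x ^ (t + m)) (Abelian.Ext.mk₀ (ez _ z hz'))
    rw [pl_mk₀, qm_ez] at this ⊢
    rw [← this]
    congr 2
    apply ez_congr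
    rw [← algebraMap_smul T (x ^ (t + m)), map_pow, hxz, ← algebraMap_smul T, map_pow]
    congr 2
    omega

lemma LC_inj (T : Type u) [CommRing T] [IsNoetherianRing R] [IsNoetherianRing T] [Algebra R T]
    (I : Type u) [AddCommGroup I] [Module R I] [Module T I] [IsScalarTower R T I]
    [Module.Injective T I] (a : Ideal R) (i : ℕ) (hi : 0 < i) : LC a i (ModuleCat.of R I) := by
  obtain ⟨s, hs⟩ := IsNoetherian.noetherian a
  have : Ideal.span {x | x ∈ s.toList} = a := by rw [← hs]; simp [Ideal.span]
  rw [← this]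
  exact LC_of_IZ _ _ _ (IZ_inj T I _ i hi)

lemma LC_bound [IsNoetherianRing R] (a : Ideal R) : ∃ n, ∀ i, n < i → ∀ N : ModuleCat.{u} R,
    LC a i N := by
  obtain ⟨s, hs⟩ := IsNoetherian.noetherian a
  have : Ideal.span {x | x ∈ s.toList} = a := by rw [← hs]; simp [Ideal.span]
  rw [← this]
  exact ⟨_, fun i hi N => LC_of_IZ _ _ _ (IZ_Jp s.toList i hi N)⟩

end PartD

section PartE
open Limits Opposite
variable {R : Type u} [CommRing R]

/-- short exactness for linear maps -/
structure SE {A B C : Type u} [AddCommGroup A] [AddCommGroup B] [AddCommGroup C] [Module R A]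
    [Module R B] [Module R C] (f : A →ₗ[R] B) (g : B →ₗ[R] C) : Prop where
  inj : Function.Injective f
  surj : Function.Surjective g
  ex : Function.Exact f g

section
variable {A B C : Type u} [AddCommGroup A] [AddCommGroup B] [AddCommGroup C] [Module R A]
    [Module R B] [Module R C] {f : A →ₗ[R] B} {g : B →ₗ[R] C}

lemma SE.ses (h : SE f g) :
    (ShortComplex.mk (ModuleCat.ofHom f) (ModuleCat.ofHom g) (ses_w f g h.ex)).ShortExact :=
  ses_of f g h.inj h.surj h.ex _

/-- covariant connecting map -/
def cd (h : SE f g) {X : ModuleCat.{u} R} {i : ℕ} (e : Abelian.Ext X (ModuleCat.of R C) i) :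
    Abelian.Ext X (ModuleCat.of R A) (i + 1) :=
  Abelian.Ext.comp e h.ses.extClass rfl

/-- contravariant connecting map -/
def dd (h : SE f g) {N : ModuleCat.{u} R} {i : ℕ} (e : Abelian.Ext (ModuleCat.of R A) N i) :
    Abelian.Ext (ModuleCat.of R C) N (1 + i) :=
  Abelian.Ext.comp h.ses.extClass e rfl

lemma cd_pl (h : SE f g) {X X' : ModuleCat.{u} R} {i : ℕ} (q : X' ⟶ X)
    (e : Abelian.Ext X (ModuleCat.of R C) i) : cd h (pl q e) = pl q (cd h e) := by
  unfold cd pl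
  exact (Abelian.Ext.comp_assoc _ _ _ (zero_add i) rfl (by omega))

lemma cd_zero (h : SE f g) {X : ModuleCat.{u} R} {i : ℕ} :
    cd h (0 : Abelian.Ext X (ModuleCat.of R C) i) = 0 := by
  unfold cd
  exact Abelian.Ext.zero_comp (X := X) (Y := ModuleCat.of R C) (C := ModuleCat.{u} R) _ _ _ _

lemma dd_zero (h : SE f g) {N : ModuleCat.{u} R} {i : ℕ} :
    dd h (0 : Abelian.Ext (ModuleCat.of R A) N i) = 0 := by
  unfold dd
  exact Abelian.Ext.comp_zero _ _ _ _ _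

lemma cd_pu (h : SE f g) {X : ModuleCat.{u} R} {i : ℕ}
    (e : Abelian.Ext X (ModuleCat.of R B) i) : cd h (pu e (ModuleCat.ofHom g)) = 0 := by
  unfold cd pu
  refine (Abelian.Ext.comp_assoc _ _ _ (add_zero i) (zero_add 1) (by omega)).trans ?_
  exact (congrArg (fun q => Abelian.Ext.comp e q rfl) h.ses.comp_extClass).trans
    (Abelian.Ext.comp_zero _ _ _ _ _)

lemma cex1 (h : SE f g) {X : ModuleCat.{u} R} {i : ℕ}
    (e : Abelian.Ext X (ModuleCat.of R A) (i + 1)) (he : pu e (ModuleCat.ofHom f) = 0) :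
    ∃ e' : Abelian.Ext X (ModuleCat.of R C) i, cd h e' = e :=
  Abelian.Ext.covariant_sequence_exact₁ X h.ses e he rfl

lemma cex2 (h : SE f g) {X : ModuleCat.{u} R} {i : ℕ}
    (e : Abelian.Ext X (ModuleCat.of R B) i) (he : pu e (ModuleCat.ofHom g) = 0) :
    ∃ e' : Abelian.Ext X (ModuleCat.of R A) i, pu e' (ModuleCat.ofHom f) = e :=
  Abelian.Ext.covariant_sequence_exact₂ X h.ses e he

lemma cex3 (h : SE f g) {X : ModuleCat.{u} R} {i : ℕ}
    (e : Abelian.Ext X (ModuleCat.of R C) i) (he : cd h e = 0) :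
    ∃ e' : Abelian.Ext X (ModuleCat.of R B) i, pu e' (ModuleCat.ofHom g) = e :=
  Abelian.Ext.covariant_sequence_exact₃ X h.ses e rfl he

lemma dex1 (h : SE f g) {N : ModuleCat.{u} R} {i : ℕ}
    (e : Abelian.Ext (ModuleCat.of R A) N i) (he : dd h e = 0) :
    ∃ e' : Abelian.Ext (ModuleCat.of R B) N i, pl (ModuleCat.ofHom f) e' = e :=
  Abelian.Ext.contravariant_sequence_exact₁ h.ses N e rfl he

lemma dex2 (h : SE f g) {N : ModuleCat.{u} R} {i : ℕ}
    (e : Abelian.Ext (ModuleCat.of R B) N i) (he : pl (ModuleCat.ofHom f) e = 0) :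
    ∃ e' : Abelian.Ext (ModuleCat.of R C) N i, pl (ModuleCat.ofHom g) e' = e :=
  Abelian.Ext.contravariant_sequence_exact₂ h.ses N e he

lemma dex3 (h : SE f g) {N : ModuleCat.{u} R} {i : ℕ}
    (e : Abelian.Ext (ModuleCat.of R C) N (1 + i)) (he : pl (ModuleCat.ofHom g) e = 0) :
    ∃ e' : Abelian.Ext (ModuleCat.of R A) N i, dd h e' = e :=
  Abelian.Ext.contravariant_sequence_exact₃ h.ses N e he rfl

lemma LC_def (a : Ideal R) (i : ℕ) (N : ModuleCat.{u} R) : LC a i N ↔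
    ∀ t, ∀ e : Abelian.Ext (ModuleCat.of R (R ⧸ a ^ t)) N i, ∃ s, ∃ h : t ≤ s,
      pl (qp (a ^ s) (a ^ t) (Ideal.pow_le_pow_right h)) e = 0 := Iff.rfl

lemma LC_mid (h : SE f g) (a : Ideal R) (i : ℕ) (h1 : LC a i (ModuleCat.of R A))
    (h3 : LC a i (ModuleCat.of R C)) : LC a i (ModuleCat.of R B) := by
  rw [LC_def] at *
  intro t e
  obtain ⟨s, hs, h0⟩ := h3 t (pu e (ModuleCat.ofHom g))
  rw [pl_pu] at h0
  obtain ⟨e1, he1⟩ := cex2 h _ h0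
  obtain ⟨r, hr, h0⟩ := h1 s e1
  refine ⟨r, hs.trans hr, ?_⟩
  rw [← qp_comp _ _ _ (Ideal.pow_le_pow_right hr) (Ideal.pow_le_pow_right hs), ← pl_pl, ← he1,
    pl_pu, h0, pu_zero]

lemma LC_third (h : SE f g) (a : Ideal R) (i : ℕ) (h1 : LC a (i + 1) (ModuleCat.of R A))
    (h2 : LC a i (ModuleCat.of R B)) : LC a i (ModuleCat.of R C) := by
  rw [LC_def] at *
  intro t e
  obtain ⟨s, hs, h0⟩ := h1 t (cd h e)
  rw [← cd_pl] at h0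
  obtain ⟨e1, he1⟩ := cex3 h _ h0
  obtain ⟨r, hr, h0⟩ := h2 s e1
  refine ⟨r, hs.trans hr, ?_⟩
  rw [← qp_comp _ _ _ (Ideal.pow_le_pow_right hr) (Ideal.pow_le_pow_right hs), ← pl_pl, ← he1,
    pl_pu, h0, pu_zero]

lemma LC_first (h : SE f g) (a : Ideal R) (i : ℕ) (h3 : LC a i (ModuleCat.of R C))
    (h2 : LC a (i + 1) (ModuleCat.of R B)) : LC a (i + 1) (ModuleCat.of R A) := by
  rw [LC_def] at *
  intro t e
  obtain ⟨s, hs, h0⟩ := h2 t (pu e (ModuleCat.ofHom f))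
  rw [pl_pu] at h0
  obtain ⟨e1, he1⟩ := cex1 h _ h0
  obtain ⟨r, hr, h0⟩ := h3 s e1
  refine ⟨r, hs.trans hr, ?_⟩
  rw [← qp_comp _ _ _ (Ideal.pow_le_pow_right hr) (Ideal.pow_le_pow_right hs), ← pl_pl, ← he1,
    ← cd_pl, h0, cd_zero]

lemma LC_zero_iff (a : Ideal R) : LC a 0 (ModuleCat.of R A) ↔
    ∀ (t : ℕ) (n : A), (∀ u ∈ a ^ t, u • n = 0) → n = 0 := by
  rw [LC_def]
  constructor
  · intro h t n hn
    obtain ⟨s, hs, h0⟩ := h t (Abelian.Ext.mk₀ (ez _ n hn))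
    rw [pl_mk₀, qp, qm_ez, Abelian.Ext.mk₀_eq_zero_iff] at h0
    have := congrArg (fun q => q.hom (Submodule.Quotient.mk 1)) h0
    change (1 : R) • (1 : R) • n = 0 at this
    simpa using this
  · intro h t e
    obtain ⟨f, rfl⟩ := ext0 e
    obtain ⟨z, hz, rfl⟩ := ez_surj _ f
    refine ⟨t, le_rfl, ?_⟩
    rw [pl_mk₀, qp, qm_ez, Abelian.Ext.mk₀_eq_zero_iff]
    obtain rfl := h t z hz
    apply ModuleCat.hom_ext
    apply LinearMap.ext
    intro x
    obtain ⟨x, rfl⟩ := Submodule.mkQ_surjective _ x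
    change x • (1 : R) • (0 : A) = 0
    simp

lemma LC_one_iff (h : SE f g) (a : Ideal R) (h2 : LC a 1 (ModuleCat.of R B)) :
    LC a 1 (ModuleCat.of R A) ↔ ∀ (t : ℕ) (n : C), (∀ u ∈ a ^ t, u • n = 0) →
      ∃ (s : ℕ) (m : B), (∀ u ∈ a ^ s, u • m = 0) ∧ g m = n := by
  rw [LC_def] at *
  constructor
  · intro h1 t n hn
    obtain ⟨s, hs, h0⟩ := h1 t (cd h (Abelian.Ext.mk₀ (ez _ n hn)))
    rw [← cd_pl] at h0
    obtain ⟨e1, he1⟩ := cex3 h _ h0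
    obtain ⟨q, rfl⟩ := ext0 e1
    obtain ⟨m, hm, rfl⟩ := ez_surj _ q
    refine ⟨s, m, hm, ?_⟩
    rw [pl_mk₀, qp, qm_ez, pu_mk₀] at he1
    have := (Abelian.Ext.mk₀_bijective _ _).1 he1
    have := congrArg (fun q => q.hom (Submodule.Quotient.mk 1)) this
    change g ((1 : R) • m) = (1 : R) • (1 : R) • n at this
    simpa using this
  · intro h1 t e
    obtain ⟨s, hs, h0⟩ := h2 t (pu e (ModuleCat.ofHom f))
    rw [pl_pu] at h0
    obtain ⟨e1, he1⟩ := cex1 h _ h0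
    obtain ⟨q, rfl⟩ := ext0 e1
    obtain ⟨n, hn, rfl⟩ := ez_surj _ q
    obtain ⟨r, m, hm, hmn⟩ := h1 s n hn
    have hr : s ≤ max r s := le_max_right _ _
    have hm' : ∀ u ∈ a ^ (max r s), u • m = 0 := fun u hu =>
      hm u (Ideal.pow_le_pow_right (le_max_left _ _) hu)
    refine ⟨max r s, hs.trans hr, ?_⟩
    rw [← qp_comp _ _ _ (Ideal.pow_le_pow_right hr) (Ideal.pow_le_pow_right hs), ← pl_pl, ← he1,
      ← cd_pl, ← cd_pu h (Abelian.Ext.mk₀ (ez _ m hm')), pl_mk₀, pu_mk₀]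
    congr 2
    rw [qp, qm_ez]
    apply ModuleCat.hom_ext
    apply LinearMap.ext
    intro x
    obtain ⟨x, rfl⟩ := Submodule.mkQ_surjective _ x
    change x • (1 : R) • n = g (x • m)
    rw [map_smul, hmn, one_smul]

lemma LC_retract (a : Ideal R) (i : ℕ) {N N' : ModuleCat.{u} R} (p : N ⟶ N') (q : N' ⟶ N)
    (hpq : p ≫ q = 𝟙 N) (h : LC a i N') : LC a i N := by
  rw [LC_def] at *
  intro t e
  obtain ⟨s, hs, h0⟩ := h t (pu e p)
  refine ⟨s, hs, ?_⟩
  have := congrArg (fun e => pu e q) h0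
  simp only [pl_pu, pu_pu, hpq, pu_id, pu_zero] at this
  exact this

lemma LC_equiv (a : Ideal R) (i : ℕ) (e : A ≃ₗ[R] B) (h : LC a i (ModuleCat.of R A)) :
    LC a i (ModuleCat.of R B) :=
  LC_retract a i (ModuleCat.ofHom e.symm.toLinearMap) (ModuleCat.ofHom e.toLinearMap) (by
    rw [← ModuleCat.ofHom_comp]; simp) h

end

/-- base independence -/
lemma map_kill (T : Type u) [CommRing T] [Algebra R T] (N : Type u) [AddCommGroup N] [Module R N]
    [Module T N] [IsScalarTower R T N] (a : Ideal R) (t : ℕ) (n : N) :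
    (∀ u ∈ (a.map (algebraMap R T)) ^ t, u • n = 0) ↔ (∀ u ∈ a ^ t, u • n = 0) := by
  rw [← Ideal.map_pow]
  constructor
  · intro h u hu
    rw [← algebraMap_smul T]; exact h _ (Ideal.mem_map_of_mem _ hu)
  · intro h u hu
    induction hu using Submodule.span_induction with
      | mem u hu =>
        obtain ⟨v, hv, rfl⟩ := hu
        rw [algebraMap_smul]
        exact h v hv
      | zero => simp
      | add a b _ _ ha hb => rw [add_smul, ha, hb, add_zero]
      | smul c b _ hb => rw [smul_assoc, hb, smul_zero]

lemma exists_inj (R : Type u) [CommRing R] (T : Type u) [CommRing T] [Algebra R T] (N : Type u)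
    [AddCommGroup N] [Module T N] :
    ∃ (I : Type u) (_ : AddCommGroup I) (_ : Module T I) (_ : Module R I) (_ : IsScalarTower R T I)
      (_ : Module.Injective T I) (f : N →ₗ[T] I), Function.Injective f := by
  let I := Injective.under (ModuleCat.of T N)
  let f := Injective.ι (ModuleCat.of T N)
  let _ : Module R I := Module.compHom I (algebraMap R T)
  have : IsScalarTower R T I := ⟨fun r t x => by
    rw [Algebra.smul_def, mul_smul]; rfl⟩
  have : Injective (ModuleCat.of T I) := inferInstanceAs (Injective (Injective.under (ModuleCat.of T N)))
  refine ⟨I, inferInstance, inferInstance, inferInstance, inferInstance,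
    Module.injective_module_of_injective_object T I, f.hom, ?_⟩
  exact (ModuleCat.mono_iff_injective f).1 inferInstance

lemma base_indep (T : Type u) [CommRing T] [IsNoetherianRing R] [IsNoetherianRing T] [Algebra R T]
    (a : Ideal R) (i : ℕ) : ∀ (N : Type u) [AddCommGroup N] [Module R N]
    [Module T N] [IsScalarTower R T N],
    LC (a.map (algebraMap R T)) i (ModuleCat.of T N) ↔ LC a i (ModuleCat.of R N) := by
  induction i with
  | zero =>
    intro N _ _ _ _
    rw [LC_zero_iff, LC_zero_iff]
    exact forall_congr' fun t => forall_congr' fun n => by rw [map_kill]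
  | succ i ih =>
    intro N _ _ _ _
    obtain ⟨I, _, _, _, _, _, f, hf⟩ := exists_inj R T N
    have hT : SE f (LinearMap.range f).mkQ := ⟨hf, Submodule.mkQ_surjective _,
      LinearMap.exact_map_mkQ_range f⟩
    have hR : SE (f.restrictScalars R) ((LinearMap.range f).mkQ.restrictScalars R) :=
      ⟨hT.inj, hT.surj, hT.ex⟩
    have hIR : ∀ i, 0 < i → LC a i (ModuleCat.of R I) := LC_inj T I a
    have hIT : ∀ i, 0 < i → LC (a.map (algebraMap R T)) i (ModuleCat.of T I) :=
      LC_inj T I (a.map (algebraMap R T))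
    rcases Nat.eq_zero_or_pos i with rfl | hi
    · rw [LC_one_iff hT _ (hIT 1 one_pos), LC_one_iff hR _ (hIR 1 one_pos)]
      refine forall_congr' fun t => forall_congr' fun n => ?_
      simp only [map_kill]
      rfl
    · have := ih (I ⧸ LinearMap.range f)
      constructor
      · intro h
        exact LC_first hR a i (this.1 (LC_third hT _ i h (hIT i hi))) (hIR _ (by omega))
      · intro h
        exact LC_first hT _ i (this.2 (LC_third hR _ i h (hIR i hi))) (hIT _ (by omega))

end PartE

section PartF
open Limits Opposite
variable {R : Type u} [CommRing R]

/-- all Ext classes vanish -/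
def EV (i : ℕ) (X N : Type u) [AddCommGroup X] [AddCommGroup N] [Module R X] [Module R N] : Prop :=
  ∀ e : Abelian.Ext (ModuleCat.of R X) (ModuleCat.of R N) i, e = 0

section
variable {A B C N : Type u} [AddCommGroup A] [AddCommGroup B] [AddCommGroup C] [Module R A]
    [Module R B] [Module R C] {f : A →ₗ[R] B} {g : B →ₗ[R] C} [AddCommGroup N] [Module R N]

lemma EV_retract {i : ℕ} (e : A ≃ₗ[R] B) (h : EV (R := R) i A N) : EV (R := R) i B N := by
  intro x
  have h0 := h (pl (ModuleCat.ofHom e.toLinearMap) x)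
  have := congrArg (fun y => pl (ModuleCat.ofHom e.symm.toLinearMap) y) h0
  simp only [pl_pl, pl_zero, ← ModuleCat.ofHom_comp] at this
  have h1 : e.toLinearMap ∘ₗ e.symm.toLinearMap = LinearMap.id := by ext; simp
  rw [h1] at this
  rw [← this]
  simp [pl]

lemma EV_sub [Subsingleton A] (i : ℕ) : EV (R := R) i A N := by
  intro x
  have h1 : (𝟙 (ModuleCat.of R A)) = 0 := by
    apply ModuleCat.hom_ext; apply LinearMap.ext; intro x; exact Subsingleton.elim _ _
  have : x = pl (𝟙 _) x := by simp [pl]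
  rw [this, h1]
  simp [pl]

lemma EV_mid (h : SE f g) (i : ℕ) (h1 : EV (R := R) i A N) (h3 : EV (R := R) i C N) :
    EV (R := R) i B N := by
  intro e
  obtain ⟨e', rfl⟩ := dex2 h e (h1 _)
  rw [h3 e', pl_zero]

lemma se_ker (g : B →ₗ[R] C) (hg : Function.Surjective g) : SE (LinearMap.ker g).subtype g :=
  ⟨Subtype.val_injective, hg, LinearMap.exact_subtype_ker_map g⟩

/-- if `e` dies on the epi `B → C` and lower Ext of the kernel vanish then `e = 0` -/
lemma zero_of_pl (g : B →ₗ[R] C) (hg : Function.Surjective g) (i : ℕ)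
    (hK : ∀ j < i, EV (R := R) j (LinearMap.ker g) N)
    (e : Abelian.Ext (ModuleCat.of R C) (ModuleCat.of R N) i)
    (he : pl (ModuleCat.ofHom g) e = 0) : e = 0 := by
  rcases Nat.eq_zero_or_pos i with rfl | hi
  · obtain ⟨q, rfl⟩ := ext0 e
    rw [pl_mk₀, Abelian.Ext.mk₀_eq_zero_iff] at he
    rw [Abelian.Ext.mk₀_eq_zero_iff]
    have := (ModuleCat.epi_iff_surjective (ModuleCat.ofHom g)).2 hg
    exact zero_of_epi_comp _ he
  · obtain ⟨j, rfl⟩ : ∃ j, i = 1 + j := ⟨i - 1, by omega⟩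
    obtain ⟨e', rfl⟩ := dex3 (se_ker g hg) e he
    rw [hK j (by omega) e', dd_zero]

end

lemma EV_of_base [IsNoetherianRing R] (a : Ideal R) (N : Type u) [AddCommGroup N] [Module R N]
    (n : ℕ) (h : ∀ i < n, EV (R := R) i (R ⧸ a) N) (i : ℕ) : i < n →
    ∀ (X : Type u) [AddCommGroup X] [Module R X] [Module.Finite R X] (_ : ∃ t, ∀ u ∈ a ^ t,
      ∀ x : X, u • x = 0), EV (R := R) i X N := by
  induction i using Nat.strong_induction_on with
  | _ i ih =>
  intro hi X _ _ hfin
  induction hfin using IsNoetherianRing.induction_on_isQuotientEquivQuotientPrime R with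
  | subsingleton X => intro _; exact EV_sub i
  | quotient X p e =>
    rintro ⟨t, ht⟩
    refine EV_retract e.symm ?_
    have hap : a ≤ p.1 := by
      have : a ^ t ≤ p.1 := by
        intro u hu
        have := ht u hu (e.symm (Submodule.Quotient.mk 1))
        rw [← map_smul, LinearEquiv.map_eq_zero_iff, ← Submodule.Quotient.mk_smul, smul_eq_mul,
          mul_one, Submodule.Quotient.mk_eq_zero] at this
        exact this
      exact Ideal.IsPrime.le_of_pow_le (hP := p.2) this
    intro x
    refine zero_of_pl (B := R ⧸ a) (Submodule.factor hap) (Submodule.factor_surjective hap) i ?_ x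
      (h i hi _)
    intro j hj
    refine ih j hj (hj.trans hi) _ ⟨1, fun u hu x => ?_⟩
    rw [pow_one] at hu
    obtain ⟨x, hx⟩ := x
    apply Subtype.ext
    change u • x = 0
    obtain ⟨x, rfl⟩ := Submodule.mkQ_surjective _ x
    rw [← map_smul]
    exact (Submodule.Quotient.mk_eq_zero _).2 (Ideal.mul_mem_right _ _ hu)
  | exact N₁ N₂ N₃ f g hf hg hfg h₁ h₃ =>
    rintro ⟨t, ht⟩
    refine EV_mid ⟨hf, hg, hfg⟩ i (h₁ ⟨t, fun u hu x => hf ?_⟩) (h₃ ⟨t, fun u hu x => ?_⟩)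
    · rw [map_smul, ht u hu, map_zero]
    · obtain ⟨x, rfl⟩ := hg x
      rw [← map_smul, ht u hu, map_zero]

lemma quot_kill (a : Ideal R) (t : ℕ) : ∀ u ∈ a ^ t, ∀ x : R ⧸ a ^ t, u • x = 0 := by
  intro u hu x
  obtain ⟨x, rfl⟩ := Submodule.mkQ_surjective _ x
  rw [← map_smul]
  exact (Submodule.Quotient.mk_eq_zero _).2 (Ideal.mul_mem_right _ _ hu)

lemma LC_of_EV [IsNoetherianRing R] (a : Ideal R) (N : Type u) [AddCommGroup N] [Module R N]
    (n : ℕ) (h : ∀ i < n, EV (R := R) i (R ⧸ a) N) (i : ℕ) (hi : i < n) :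
    LC a i (ModuleCat.of R N) := by
  intro t e
  refine ⟨t, le_rfl, ?_⟩
  have := EV_of_base a N n h i hi (R ⧸ a ^ t) ⟨t, quot_kill a t⟩ e
  rw [this]
  exact pl_zero _

lemma EV_of_LC [IsNoetherianRing R] (a : Ideal R) (N : Type u) [AddCommGroup N] [Module R N]
    (n : ℕ) (h : ∀ i < n, LC a i (ModuleCat.of R N)) (i : ℕ) : i < n →
    EV (R := R) i (R ⧸ a) N := by
  induction i using Nat.strong_induction_on with
  | _ i ih =>
  intro hi e
  have h1 : a ^ 1 ≤ a := (pow_one a).le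
  obtain ⟨s, hs, h0⟩ := h i hi 1 (pl (qp _ _ h1) e)
  change pl _ _ = 0 at h0
  rw [pl_pl, qp_comp] at h0
  have hsa : a ^ s ≤ a := (Ideal.pow_le_pow_right hs).trans h1
  have hq : qp (a ^ s) a hsa = ModuleCat.ofHom (Submodule.factor hsa) := by
    apply ModuleCat.hom_ext
    apply LinearMap.ext
    intro x
    obtain ⟨x, rfl⟩ := Submodule.mkQ_surjective _ x
    change Submodule.Quotient.mk (1 * x) = Submodule.Quotient.mk x
    rw [one_mul]
  rw [hq] at h0
  refine zero_of_pl (B := R ⧸ a ^ s) (Submodule.factor hsa) (Submodule.factor_surjective hsa) i ?_ e h0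
  intro j hj
  refine EV_of_base a N i (fun k hk => ih k hk (hk.trans hi)) j hj _ ⟨s, fun u hu x => ?_⟩
  apply Subtype.ext
  exact quot_kill a s u hu x.1

lemma nak [IsNoetherianRing R] (a : Ideal R) : ∀ (I : Ideal R) (M : Type u) [AddCommGroup M]
    [Module R M] [Module.Finite R M], Module.annihilator R M = I → 
    (∀ i, EV (R := R) i (R ⧸ a) M) → a • (⊤ : Submodule R M) = ⊤ := by
  intro I
  induction I using WellFoundedGT.induction with
  | _ I ih =>
  intro M _ _ _ hI h
  have hsub : Subsingleton ((R ⧸ a) →ₗ[R] M) := by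
    refine subsingleton_of_forall_eq 0 fun f => ?_
    have := h 0 (Abelian.Ext.mk₀ (ModuleCat.ofHom f))
    rw [Abelian.Ext.mk₀_eq_zero_iff] at this
    exact congrArg ModuleCat.Hom.hom this
  obtain ⟨x, hxa, hx⟩ := IsSMulRegular.subsingleton_linearMap_iff.1 hsub
  rw [Ideal.annihilator_quotient] at hxa
  rcases subsingleton_or_nontrivial M with hM | hM
  · exact Subsingleton.elim _ _
  let P : Submodule R M := LinearMap.range (LinearMap.lsmul R M x)
  have hse : SE (LinearMap.lsmul R M x) P.mkQ := ⟨hx, Submodule.mkQ_surjective _,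
    LinearMap.exact_map_mkQ_range _⟩
  have hEV : ∀ i, EV (R := R) i (R ⧸ a) (M ⧸ P) := by
    intro i e
    obtain ⟨e', rfl⟩ := cex3 hse e (h _ _)
    rw [h _ e', pu_zero]
  have hlt : I < Module.annihilator R (M ⧸ P) := by
    rw [← hI]
    refine lt_of_le_of_ne ?_ ?_
    · intro r hr
      rw [Module.mem_annihilator] at hr ⊢
      intro m
      obtain ⟨m, rfl⟩ := Submodule.mkQ_surjective _ m
      rw [← map_smul, hr, map_zero]
    · intro heq
      have : x ∈ Module.annihilator R M := by
        rw [heq, Module.mem_annihilator]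
        intro m
        obtain ⟨m, rfl⟩ := Submodule.mkQ_surjective _ m
        rw [← map_smul]
        exact (Submodule.Quotient.mk_eq_zero _).2 ⟨m, rfl⟩
      rw [Module.mem_annihilator] at this
      obtain ⟨m, hm⟩ := exists_ne (0 : M)
      apply hm
      apply hx
      change x • m = x • 0
      rw [this, smul_zero]
  have key := ih _ hlt (M ⧸ P) rfl hEV
  have hP : P ≤ a • (⊤ : Submodule R M) := by
    rintro _ ⟨m, rfl⟩
    exact Submodule.smul_mem_smul hxa trivial
  have h2 : (a • (⊤ : Submodule R M)).map P.mkQ = ⊤ := by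
    rw [Submodule.map_smul'', Submodule.map_top, Submodule.range_mkQ, key]
  have h3 := congrArg (Submodule.comap P.mkQ) h2
  rw [Submodule.comap_map_mkQ, Submodule.comap_top, sup_eq_right.2 hP] at h3
  exact h3

lemma LC_sub (a : Ideal R) (i : ℕ) (A : Type u) [AddCommGroup A] [Module R A] [Subsingleton A] :
    LC a i (ModuleCat.of R A) := by
  intro t e
  refine ⟨t, le_rfl, ?_⟩
  have h1 : (𝟙 (ModuleCat.of R A)) = 0 := by
    apply ModuleCat.hom_ext; apply LinearMap.ext; intro x; exact Subsingleton.elim _ _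
  have : e = 0 := by
    rw [← pu_id e, h1]; simp [pu]
  rw [this]
  exact pl_zero _

lemma LC_le [IsNoetherianRing R] (a : Ideal R) (c : ℕ) (h : ∀ i, c ≤ i → LC a i (ModuleCat.of R R)) :
    ∀ i, c ≤ i → ∀ (N : Type u) [AddCommGroup N] [Module R N] [Module.Finite R N],
      LC a i (ModuleCat.of R N) := by
  obtain ⟨n, hn⟩ := LC_bound a
  suffices H : ∀ k i, c ≤ i → n < i + k → ∀ (N : Type u) [AddCommGroup N] [Module R N]
      [Module.Finite R N], LC a i (ModuleCat.of R N) by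
    intro i hi N _ _ _
    exact H (n + 1) i hi (by omega) N
  intro k
  induction k with
  | zero => intro i hi hk N _ _ _; exact hn i hk _
  | succ k ih =>
    intro i hi hk N _ _ hfin
    induction hfin using IsNoetherianRing.induction_on_isQuotientEquivQuotientPrime R with
    | subsingleton X => exact LC_sub a i X
    | quotient X p e =>
      refine LC_equiv a i e.symm ?_
      refine LC_third (f := p.1.subtype) (g := p.1.mkQ) ⟨Subtype.val_injective, Submodule.mkQ_surjective _,
        LinearMap.exact_subtype_mkQ _⟩ a i (ih (i + 1) (by omega) (by omega) _) (h i hi)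
    | exact N₁ N₂ N₃ f g hf hg hfg h₁ h₃ => exact LC_mid ⟨hf, hg, hfg⟩ a i h₁ h₃

end PartF

section PartG
variable {R : Type u} [CommRing R]

/-- degrees of non-vanishing -/
def SS (a : Ideal R) (N : Type u) [AddCommGroup N] [Module R N] : Set ℕ :=
  {i | ¬ LC a i (ModuleCat.of R N)}

lemma cohDim_eq (a : Ideal R) (N : Type u) [AddCommGroup N] [Module R N] :
    cohDim a N = sSup ((fun i : ℕ => (i : ℕ∞)) '' SS a N) := by
  unfold cohDim SS
  congr 2
  ext i
  exact lc_link ..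

lemma ext_iff_EV (a : Ideal R) (N : Type u) [AddCommGroup N] [Module R N] (i : ℕ) :
    Nontrivial (((Ext R (ModuleCat.{u} R) i).obj
      (Opposite.op (ModuleCat.of R (R ⧸ a)))).obj (ModuleCat.of R N)) ↔ ¬ EV (R := R) i (R ⧸ a) N := by
  unfold EV
  push Not
  exact nontrivial_link ..

lemma relGrade_eq [IsNoetherianRing R] (a : Ideal R) (N : Type u) [AddCommGroup N] [Module R N] :
    relGrade a N = sInf ((fun i : ℕ => (i : ℕ∞)) '' SS a N) := by
  unfold relGrade
  simp only [ext_iff_EV]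
  apply le_antisymm
  · apply le_sInf
    rintro _ ⟨i, hi, rfl⟩
    by_contra hlt
    refine hi (LC_of_EV a N (i + 1) (fun j hj => ?_) i (Nat.lt_succ_self i))
    by_contra hE
    exact hlt ((sInf_le (Set.mem_image_of_mem _ hE)).trans (Nat.cast_le.2 (Nat.lt_succ_iff.1 hj)))
  · apply le_sInf
    rintro _ ⟨i, hi, rfl⟩
    by_contra hlt
    refine hi (EV_of_LC a N (i + 1) (fun j hj => ?_) i (Nat.lt_succ_self i))
    by_contra hE
    exact hlt ((sInf_le (Set.mem_image_of_mem _ hE)).trans (Nat.cast_le.2 (Nat.lt_succ_iff.1 hj)))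

lemma SS_nonempty [IsNoetherianRing R] (a : Ideal R) (N : Type u) [AddCommGroup N] [Module R N]
    [Module.Finite R N] (h : a • (⊤ : Submodule R N) ≠ ⊤) : (SS a N).Nonempty := by
  by_contra hne
  rw [Set.not_nonempty_iff_eq_empty] at hne
  refine h (nak a _ N rfl fun i => EV_of_LC a N (i + 1) (fun j _ => ?_) i (Nat.lt_succ_self i))
  by_contra hj
  have : j ∈ SS a N := hj
  rw [hne] at this
  exact this

lemma SS_sup [IsNoetherianRing R] (a : Ideal R) (N : Type u) [AddCommGroup N] [Module R N]
    [Module.Finite R N] : sSup ((fun i : ℕ => (i : ℕ∞)) '' SS a N) ≤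
      sSup ((fun i : ℕ => (i : ℕ∞)) '' SS a R) := by
  apply sSup_le
  rintro _ ⟨i, hi, rfl⟩
  by_contra hlt
  refine hi (LC_le a i (fun j hj => ?_) i le_rfl N)
  by_contra hE
  exact hlt (le_trans (Nat.cast_le.2 hj) (le_sSup (Set.mem_image_of_mem _ hE)))

variable (M : Type u) [AddCommGroup M] [Module R M] [Module Rᵐᵒᵖ M] [IsCentralScalar R M]

lemma tsze_se : SE (TrivSqZeroExt.inrHom R M) (TrivSqZeroExt.fstHom R R M).toLinearMap := by
  refine ⟨TrivSqZeroExt.inr_injective, fun r => ⟨TrivSqZeroExt.inl r, rfl⟩, fun x => ⟨fun hx => ?_, ?_⟩⟩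
  · exact ⟨x.snd, TrivSqZeroExt.ext (Eq.symm hx) rfl⟩
  · rintro ⟨m, rfl⟩; rfl

lemma tsze_finite [Module.Finite R M] : Module.Finite R (TrivSqZeroExt R M) := by
  refine Module.Finite.of_surjective
    ((TrivSqZeroExt.inlAlgHom R R M).toLinearMap.coprod (TrivSqZeroExt.inrHom R M)) fun x => ?_
  exact ⟨(x.fst, x.snd), TrivSqZeroExt.inl_fst_add_inr_snd_eq x⟩

lemma tsze_LC (a : Ideal R) (i : ℕ) : LC a i (ModuleCat.of R (TrivSqZeroExt R M)) ↔
    LC a i (ModuleCat.of R R) ∧ LC a i (ModuleCat.of R M) := by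
  constructor
  · intro h
    refine ⟨LC_retract a i (ModuleCat.ofHom (TrivSqZeroExt.inlAlgHom R R M).toLinearMap)
      (ModuleCat.ofHom (TrivSqZeroExt.fstHom R R M).toLinearMap) ?_ h,
      LC_retract a i (ModuleCat.ofHom (TrivSqZeroExt.inrHom R M))
      (ModuleCat.ofHom (TrivSqZeroExt.sndHom R M)) ?_ h⟩
    · rfl
    · rfl
  · rintro ⟨h1, h2⟩
    exact LC_mid (tsze_se M) a i h2 h1

lemma tsze_SS [IsNoetherianRing R] [Module.Finite R M] (a : Ideal R) :
    SS (a.map (algebraMap R (TrivSqZeroExt R M))) (TrivSqZeroExt R M) = SS a R ∪ SS a M := by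
  have := tsze_finite (R := R) M
  have := IsNoetherianRing.of_finite R (TrivSqZeroExt R M)
  ext i
  change ¬ LC _ i _ ↔ ¬ _ ∨ ¬ _
  rw [base_indep (TrivSqZeroExt R M) a i (TrivSqZeroExt R M), tsze_LC, not_and_or]

end PartG

theorem stmt10 {R : Type u} [CommRing R] [IsNoetherianRing R]
    (a : Ideal R) (M : Type u) [AddCommGroup M] [Module R M] [Module Rᵐᵒᵖ M] [IsCentralScalar R M] [Module.Finite R M]
    (hM : a • (⊤ : Submodule R M) ≠ ⊤) :
    IsRelCM (a.map (algebraMap R (TrivSqZeroExt R M))) (TrivSqZeroExt R M) ↔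
      IsRelCM a R ∧ IsRelMCM a M := by
  have := tsze_finite (R := R) M
  have := IsNoetherianRing.of_finite R (TrivSqZeroExt R M)
  have ha : a ≠ ⊤ := by
    rintro rfl
    exact hM (Submodule.top_smul _)
  have haR : a • (⊤ : Submodule R R) ≠ ⊤ := by
    rw [smul_eq_mul, Ideal.mul_top]; exact ha
  have haT : (a.map (algebraMap R (TrivSqZeroExt R M))) •
      (⊤ : Submodule (TrivSqZeroExt R M) (TrivSqZeroExt R M)) ≠ ⊤ := by
    rw [smul_eq_mul, Ideal.mul_top]
    intro h
    apply ha
    have := congrArg (Ideal.map (TrivSqZeroExt.fstHom R R M).toRingHom) h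
    rw [Ideal.map_top, Ideal.map_map] at this
    have hid : (TrivSqZeroExt.fstHom R R M).toRingHom.comp (algebraMap R (TrivSqZeroExt R M)) =
      RingHom.id R := rfl
    rwa [hid, Ideal.map_id] at this
  have hA := SS_nonempty a R haR
  have hB := SS_nonempty a M hM
  have hsup := SS_sup a M
  unfold IsRelCM IsRelMCM
  simp only [haR, haT, false_or, ne_eq, not_false_eq_true, true_and, relGrade_eq, cohDim_eq,
    tsze_SS, Set.image_union, sInf_union, sSup_union]
  rw [sup_eq_left.2 hsup]
  have le : ∀ S : Set ℕ, S.Nonempty → sInf ((fun i : ℕ => (i : ℕ∞)) '' S) ≤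
      sSup ((fun i : ℕ => (i : ℕ∞)) '' S) := fun S hS => sInf_le_sSup (hS.image _)
  constructor
  · intro h
    exact ⟨le_antisymm (le _ hA) (h ▸ inf_le_left),
      le_antisymm ((le _ hB).trans hsup) (h ▸ inf_le_right)⟩
  · rintro ⟨h1, h2⟩
    rw [h1, h2, inf_idem]

end
end
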